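/- arXiv:2306.00737 — 3 statements merged into one kernel-verified Lean document; each statement's English description precedes it below -/
import Mathlib

section
/- Let R = C[a_{11}, a_{12}, a_{21}, a_{22}, b_{11}, b_{12}, b_{21}, b_{22}] and let I_2 be the ideal generated by the entries of the commutator AB - BA, where A = (a_{ij}) and B = (b_{ij}) are generic 2×2 matrices. Then the degree of the projective variety V(I_2) (the commuting variety C_2) equals 3. -/
open MvPolynomial

/-- dim_C of the degree-`t` piece of `R/I` (image of degree-`t` forms in the quotient). -/
noncomputable def gradedPieceDim {σ : Type*} (I : Ideal (MvPolynomial σ ℂ)) (t : ℕ) : ℕ :=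
  Module.finrank ℂ ((MvPolynomial.homogeneousSubmodule σ ℂ t).map
    (Ideal.Quotient.mkₐ ℂ I).toLinearMap)

/-- `V(I)` has degree `d`: the Hilbert function eventually agrees with a polynomial `P`,
and `(deg P)! · (leading coefficient of P) = d`. -/
def VarietyHasDegree {σ : Type*} (I : Ideal (MvPolynomial σ ℂ)) (d : ℕ) : Prop :=
  ∃ P : Polynomial ℚ, (∃ n₀ : ℕ, ∀ t : ℕ, n₀ ≤ t → P.eval (t : ℚ) = gradedPieceDim I t) ∧
    (Nat.factorial P.natDegree : ℚ) * P.leadingCoeff = d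

/-- The monomial `p^α q^β x^m y^n`, the exponents of the families `p` and `q` being multisets. -/
def pairMonomial {ι A : Type*} [CommMonoid A] (p q : ι → A) (x y : A)
    (α β : Multiset ι) (m n : ℕ) : A :=
  (α.map p).prod * (β.map q).prod * x ^ m * y ^ n

/-- Indices of the standard monomials of degree `t` in the coordinate ring of a Segre variety
`ℙ¹ × ℙ(ι)` with two free variables adjoined. -/
abbrev SegreIndex (ι : Type*) (t : ℕ) : Type _ :=
  Σ k : Fin (t + 1), Sym ι k × Fin (k + 1) × Fin (t - k + 1)

/-- The standard monomial attached to an index: the first `r` factors are taken from `p`, the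
others from `q`. -/
noncomputable def standardMonomial {ι A : Type*} [CommMonoid A] (p q : ι → A) (x y : A) {t : ℕ}
    (j : SegreIndex ι t) : A :=
  pairMonomial p q x y ((j.2.1 : Multiset ι).toList.take j.2.2.1 : Multiset ι)
    ((j.2.1 : Multiset ι).toList.drop j.2.2.1 : Multiset ι) j.2.2.2 (t - j.1 - j.2.2.2)

section PairMonomial

open scoped Pointwise

variable {ι A : Type*} [CommMonoid A] {p q : ι → A}

theorem prod_map_mul_prod_map_swap (h : ∀ i j, p i * q j = p j * q i) (s t : Multiset ι)
    (hst : s.card = t.card) :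
    (s.map p).prod * (t.map q).prod = (t.map p).prod * (s.map q).prod := by
  induction s using Multiset.induction generalizing t with
  | empty =>
    obtain rfl : t = 0 := by simpa using hst.symm
    simp
  | cons a s ih =>
    induction t using Multiset.induction with
    | empty => simp at hst
    | cons b t _ =>
      simp only [Multiset.card_cons, add_left_inj] at hst
      simp only [Multiset.map_cons, Multiset.prod_cons]
      rw [mul_mul_mul_comm, h a b, ih t hst, mul_mul_mul_comm]

theorem pairMonomial_congr [DecidableEq ι] (h : ∀ i j, p i * q j = p j * q i) (x y : A)
    {α β α' β' : Multiset ι} (hadd : α + β = α' + β') (hcard : α.card = α'.card) (m n : ℕ) :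
    pairMonomial p q x y α β m n = pairMonomial p q x y α' β' m n := by
  have hα : α ∩ α' + (α - α') = α := by rw [add_comm, Multiset.sub_add_inter]
  have hα' : α ∩ α' + (α' - α) = α' := by
    rw [Multiset.inter_comm, add_comm, Multiset.sub_add_inter]
  have hβ : (β ∩ β') + (α' - α) = β := by
    ext i
    have := congrArg (Multiset.count i) hadd
    simp only [Multiset.count_add, Multiset.count_sub, Multiset.count_inter] at this ⊢
    omega
  have hβ' : (β ∩ β') + (α - α') = β' := by
    ext i
    have := congrArg (Multiset.count i) hadd
    simp only [Multiset.count_add, Multiset.count_sub, Multiset.count_inter] at this ⊢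
    omega
  have hc : (α - α').card = (α' - α).card := by
    have h₁ := congrArg Multiset.card hα
    have h₂ := congrArg Multiset.card hα'
    simp only [Multiset.card_add] at h₁ h₂
    omega
  have key := prod_map_mul_prod_map_swap h _ _ hc
  have hprod : (α.map p).prod * (β.map q).prod = (α'.map p).prod * (β'.map q).prod := by
    calc (α.map p).prod * (β.map q).prod
        = ((α ∩ α' + (α - α')).map p).prod * ((β ∩ β' + (α' - α)).map q).prod := by rw [hα, hβ]
      _ = ((α ∩ α' + (α' - α)).map p).prod * ((β ∩ β' + (α - α')).map q).prod := by
        simp only [Multiset.map_add, Multiset.prod_add]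
        rw [mul_mul_mul_comm, key, mul_mul_mul_comm]
      _ = (α'.map p).prod * (β'.map q).prod := by rw [hα', hβ']
  rw [pairMonomial, pairMonomial, hprod]

theorem exists_standardMonomial_eq [DecidableEq ι] (h : ∀ i j, p i * q j = p j * q i) (x y : A)
    {t : ℕ} (α β : Multiset ι) {m n : ℕ} (ht : α.card + β.card + m + n = t) :
    ∃ j : SegreIndex ι t, standardMonomial p q x y j = pairMonomial p q x y α β m n := by
  refine ⟨⟨⟨α.card + β.card, by omega⟩, ⟨α + β, by simp⟩, ⟨α.card, by simp only; omega⟩,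
    ⟨m, by simp only; omega⟩⟩, ?_⟩
  have hn : t - (α.card + β.card) - m = n := by omega
  simp only [standardMonomial, hn, Sym.coe_mk]
  refine pairMonomial_congr h x y ?_ ?_ _ _
  · rw [Multiset.coe_add, List.take_append_drop, Multiset.coe_toList]
  · simp

theorem mem_range_standardMonomial [DecidableEq ι] (h : ∀ i j, p i * q j = p j * q i) (x y : A)
    {t : ℕ} {a : A} (ha : a ∈ (Set.range p ∪ Set.range q ∪ {x, y}) ^ t) :
    a ∈ Set.range (standardMonomial p q x y (t := t)) := by
  suffices H : ∃ (α β : Multiset ι) (m n : ℕ), α.card + β.card + m + n = t ∧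
      a = pairMonomial p q x y α β m n by
    obtain ⟨α, β, m, n, ht, rfl⟩ := H
    exact exists_standardMonomial_eq h x y α β ht
  induction t generalizing a with
  | zero => exact ⟨0, 0, 0, 0, by simp, by simpa [pairMonomial] using ha⟩
  | succ t ih =>
    rw [pow_succ] at ha
    obtain ⟨b, hb, c, hc, rfl⟩ := ha
    obtain ⟨α, β, m, n, ht, rfl⟩ := ih hb
    rcases hc with (⟨i, rfl⟩ | ⟨i, rfl⟩) | rfl | rfl
    · refine ⟨i ::ₘ α, β, m, n, by simp; omega, ?_⟩
      simp only [pairMonomial, Multiset.map_cons, Multiset.prod_cons]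
      ac_rfl
    · refine ⟨α, i ::ₘ β, m, n, by simp; omega, ?_⟩
      simp only [pairMonomial, Multiset.map_cons, Multiset.prod_cons]
      ac_rfl
    · refine ⟨α, β, m + 1, n, by omega, ?_⟩
      simp only [pairMonomial, pow_succ]
      ac_rfl
    · refine ⟨α, β, m, n + 1, by omega, ?_⟩
      simp only [pairMonomial, pow_succ]
      ac_rfl

theorem prod_map_mem_pow_card {s : Set A} {f : ι → A} (hf : ∀ i, f i ∈ s) (α : Multiset ι) :
    (α.map f).prod ∈ s ^ α.card := by
  induction α using Multiset.induction with
  | empty => simp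
  | cons i α ih =>
    rw [Multiset.map_cons, Multiset.prod_cons, Multiset.card_cons, pow_succ']
    exact Set.mul_mem_mul (hf i) ih

theorem standardMonomial_mem_pow (p q : ι → A) (x y : A) {t : ℕ} (j : SegreIndex ι t) :
    standardMonomial p q x y j ∈ (Set.range p ∪ Set.range q ∪ {x, y}) ^ t := by
  obtain ⟨⟨k, hk⟩, ⟨γ, hγ⟩, ⟨r, hr⟩, ⟨m, hm⟩⟩ := j
  simp only at hγ hr hm
  have ht : t = r + (k - r) + m + (t - k - m) := by omega
  have h₁ := prod_map_mem_pow_card (s := Set.range p ∪ Set.range q ∪ {x, y}) (f := p)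
    (by simp) (γ.toList.take r : Multiset ι)
  have h₂ := prod_map_mem_pow_card (s := Set.range p ∪ Set.range q ∪ {x, y}) (f := q)
    (by simp) (γ.toList.drop r : Multiset ι)
  have hr' : min r k = r := by omega
  simp only [Multiset.coe_card, List.length_take, List.length_drop, Multiset.length_toList,
    hγ, hr'] at h₁ h₂
  have hx : x ∈ Set.range p ∪ Set.range q ∪ {x, y} := by simp
  have hy : y ∈ Set.range p ∪ Set.range q ∪ {x, y} := by simp
  have hmem := Set.mul_mem_mul (Set.mul_mem_mul (Set.mul_mem_mul h₁ h₂)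
    (Set.pow_mem_pow (n := m) hx)) (Set.pow_mem_pow (n := t - k - m) hy)
  rwa [← pow_add, ← pow_add, ← pow_add, ← ht] at hmem

end PairMonomial

section Rank

open scoped Pointwise

variable {ι K : Type*} [CommRing K]

/-- The exponent of the image of a standard monomial under the Segre parametrization. -/
noncomputable def segreExponent {t : ℕ} (j : SegreIndex ι t) : Multiset (ι ⊕ Fin 4) :=
  (j.2.1 : Multiset ι).map Sum.inl + Multiset.replicate j.2.2.1 (Sum.inr 0) +
    Multiset.replicate (j.1 - j.2.2.1) (Sum.inr 1) + Multiset.replicate j.2.2.2 (Sum.inr 2) +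
    Multiset.replicate (t - j.1 - j.2.2.2) (Sum.inr 3)

theorem segreExponent_injective [DecidableEq ι] {t : ℕ} :
    Function.Injective (segreExponent (ι := ι) (t := t)) := by
  rintro ⟨⟨k, hk⟩, ⟨γ, hγ⟩, ⟨r, hr⟩, ⟨m, hm⟩⟩ ⟨⟨k', hk'⟩, ⟨γ', hγ'⟩, ⟨r', hr'⟩, ⟨m', hm'⟩⟩ h
  simp only at hγ hγ' hr hr' hm hm'
  have hnot (c : Fin 4) (s : Multiset ι) : Multiset.count (Sum.inr c) (s.map Sum.inl) = 0 :=
    Multiset.count_eq_zero_of_notMem (by simp)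
  have hγγ : γ = γ' := by
    ext i
    have := congrArg (Multiset.count (Sum.inl i)) h
    simpa [segreExponent, Multiset.count_replicate,
      Multiset.count_map_eq_count' _ _ Sum.inl_injective] using this
  have hrr : r = r' := by
    have := congrArg (Multiset.count (Sum.inr 0)) h
    simpa [segreExponent, Multiset.count_replicate, hnot] using this
  have hmm : m = m' := by
    have := congrArg (Multiset.count (Sum.inr 2)) h
    simpa [segreExponent, Multiset.count_replicate, hnot] using this
  subst hγγ hrr hmm
  obtain rfl : k = k' := hγ.symm.trans hγ'
  rfl

theorem prod_map_X_eq_monomial {σ : Type*} [DecidableEq σ] (s : Multiset σ) :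
    (s.map (X : σ → MvPolynomial σ K)).prod = monomial (Multiset.toFinsupp s) 1 := by
  induction s using Multiset.induction with
  | empty => simp
  | cons i s ih =>
    rw [Multiset.map_cons, Multiset.prod_cons, ih, ← Multiset.singleton_add,
      Multiset.toFinsupp_add, Multiset.toFinsupp_singleton, X, monomial_mul, one_mul]

variable {A : Type*} [CommRing A] [Algebra K A] {p q : ι → A} {x y : A}

theorem map_standardMonomial [DecidableEq ι] (ψ : A →ₐ[K] MvPolynomial (ι ⊕ Fin 4) K)
    (hp : ∀ i, ψ (p i) = X (Sum.inr 0) * X (Sum.inl i))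
    (hq : ∀ i, ψ (q i) = X (Sum.inr 1) * X (Sum.inl i))
    (hx : ψ x = X (Sum.inr 2)) (hy : ψ y = X (Sum.inr 3)) {t : ℕ} (j : SegreIndex ι t) :
    ψ (standardMonomial p q x y j) = monomial (Multiset.toFinsupp (segreExponent j)) 1 := by
  obtain ⟨⟨k, hk⟩, ⟨γ, hγ⟩, ⟨r, hr⟩, ⟨m, hm⟩⟩ := j
  simp only at hγ hr hm
  have hr' : min r k = r := by omega
  have hsplit : γ = (γ.toList.take r : Multiset ι) + (γ.toList.drop r : Multiset ι) := by
    rw [Multiset.coe_add, List.take_append_drop, Multiset.coe_toList]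
  have h₁ : (γ.toList.take r : Multiset ι).card = r := by simp [hγ, hr']
  have h₂ : (γ.toList.drop r : Multiset ι).card = k - r := by simp [hγ]
  rw [← prod_map_X_eq_monomial]
  simp only [standardMonomial, segreExponent, pairMonomial, Sym.coe_mk]
  conv_rhs => rw [hsplit]
  generalize (γ.toList.take r : Multiset ι) = α at *
  generalize (γ.toList.drop r : Multiset ι) = β at *
  simp only [map_mul, map_pow, map_multiset_prod, Multiset.map_map, Function.comp_def, hp, hq,
    hx, hy, Multiset.prod_map_mul, Multiset.map_const', Multiset.prod_replicate, h₁, h₂,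
    Multiset.map_add, Multiset.prod_add, Multiset.map_replicate]
  ring

theorem finrank_span_pow_eq_card [Nontrivial K] [Fintype ι] [DecidableEq ι]
    (h : ∀ i j, p i * q j = p j * q i) (ψ : A →ₐ[K] MvPolynomial (ι ⊕ Fin 4) K)
    (hp : ∀ i, ψ (p i) = X (Sum.inr 0) * X (Sum.inl i))
    (hq : ∀ i, ψ (q i) = X (Sum.inr 1) * X (Sum.inl i))
    (hx : ψ x = X (Sum.inr 2)) (hy : ψ y = X (Sum.inr 3)) (t : ℕ) :
    Module.finrank K ↥(Submodule.span K (Set.range p ∪ Set.range q ∪ {x, y}) ^ t) =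
      Fintype.card (SegreIndex ι t) := by
  have hrange : (Set.range p ∪ Set.range q ∪ {x, y}) ^ t =
      Set.range (standardMonomial p q x y (t := t)) := by
    refine Set.Subset.antisymm (fun a ha => mem_range_standardMonomial h x y ha) ?_
    rintro _ ⟨j, rfl⟩
    exact standardMonomial_mem_pow p q x y j
  rw [Submodule.span_pow, hrange]
  refine finrank_span_eq_card (LinearIndependent.of_comp ψ.toLinearMap ?_)
  have := (basisMonomials (ι ⊕ Fin 4) K).linearIndependent.comp
    (fun j : SegreIndex ι t => Multiset.toFinsupp (segreExponent j))
    (Multiset.toFinsupp.injective.comp segreExponent_injective)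
  convert! this using 1
  ext1 j
  simp [map_standardMonomial ψ hp hq hx hy]

end Rank

theorem sum_range_multichoose_three (t : ℕ) :
    (∑ k ∈ Finset.range t, ((k + 1) * Nat.multichoose 3 k : ℕ) : ℚ) =
      t * (t + 1) * (t + 2) * (3 * t + 1) / 24 := by
  have hmc (k : ℕ) : (Nat.multichoose 3 k : ℚ) = (k + 1) * (k + 2) / 2 := by
    rw [Nat.multichoose_eq, show 3 + k - 1 = k + 2 by omega, Nat.choose_symm_add,
      Nat.cast_choose_two]
    push_cast
    ring
  induction t with
  | zero => simp
  | succ t ih =>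
    push_cast [Finset.sum_range_succ, hmc] at ih ⊢
    rw [ih]
    ring

theorem card_segreIndex_fin_three (t : ℕ) :
    (Fintype.card (SegreIndex (Fin 3) t) : ℚ) =
      (t + 1) * (t + 2) * (t + 3) * (t + 4) * (3 * t + 5) / 120 := by
  have hcard (t : ℕ) : Fintype.card (SegreIndex (Fin 3) t) =
      ∑ k ∈ Finset.range (t + 1), (k + 1) * Nat.multichoose 3 k * (t - k + 1) := by
    simp only [Fintype.card_sigma, Fintype.card_prod, Fintype.card_fin,
      Sym.card_sym_eq_multichoose]
    rw [Finset.sum_range]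
    exact Finset.sum_congr rfl fun k _ => by ring
  have hstep (t : ℕ) : Fintype.card (SegreIndex (Fin 3) (t + 1)) =
      Fintype.card (SegreIndex (Fin 3) t) +
        ∑ k ∈ Finset.range (t + 2), (k + 1) * Nat.multichoose 3 k := by
    rw [hcard, hcard, Finset.sum_range_succ, Finset.sum_range_succ _ (t + 1), ← add_assoc,
      ← Finset.sum_add_distrib]
    congr 1
    · refine Finset.sum_congr rfl fun k hk => ?_
      rw [Nat.succ_sub (by simpa [Nat.lt_succ_iff] using hk), Nat.succ_eq_add_one]
      ring
    · simp
  induction t with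
  | zero => rw [hcard]; norm_num
  | succ t ih =>
    rw [hstep, Nat.cast_add, ih, Nat.cast_sum, sum_range_multichoose_three]
    push_cast
    ring

/-- The variables of the polynomial ring on the entries of two generic `2×2` matrices. -/
abbrev MatrixPairVar : Type := (Fin 2 × Fin 2) ⊕ (Fin 2 × Fin 2)

/-- The ideal of entries of the commutator of two generic `2×2` matrices. -/
noncomputable abbrev commutatorIdeal : Ideal (MvPolynomial MatrixPairVar ℂ) :=
  Ideal.span (Set.range fun p : Fin 2 × Fin 2 =>
    ∑ k : Fin 2, (X (Sum.inl (p.1, k)) * X (Sum.inr (k, p.2)) -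
      X (Sum.inr (p.1, k)) * X (Sum.inl (k, p.2))))

/-- The coordinates `c₁₂, c₂₁, c₁₁ - c₂₂` of a `2×2` matrix modulo scalar matrices. -/
def tracelessCoords {A : Type*} [Sub A] (c : Fin 2 × Fin 2 → A) : Fin 3 → A :=
  ![c (0, 1), c (1, 0), c (0, 0) - c (1, 1)]

/-- The matrix with the given traceless coordinates and lower right entry. -/
def matrixOfCoords {A : Type*} [Add A] (v : Fin 3 → A) (d : A) : Fin 2 × Fin 2 → A :=
  fun ij => ![![v 2 + d, v 0], ![v 1, d]] ij.1 ij.2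

/-- Parametrization of commuting pairs by matrices with proportional traceless coordinates. -/
noncomputable def commutingParam :
    MvPolynomial MatrixPairVar ℂ →ₐ[ℂ] MvPolynomial (Fin 3 ⊕ Fin 4) ℂ :=
  aeval (Sum.elim
    (matrixOfCoords (fun i => X (Sum.inr 0) * X (Sum.inl i)) (X (Sum.inr 2)))
    (matrixOfCoords (fun i => X (Sum.inr 1) * X (Sum.inl i)) (X (Sum.inr 3))))

theorem commutingParam_eq_zero_of_mem {f : MvPolynomial MatrixPairVar ℂ}
    (hf : f ∈ commutatorIdeal) : commutingParam f = 0 := by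
  suffices H : commutatorIdeal ≤ RingHom.ker commutingParam from H hf
  rw [Ideal.span_le]
  rintro _ ⟨⟨i, j⟩, rfl⟩
  rw [SetLike.mem_coe, RingHom.mem_ker]
  fin_cases i <;> fin_cases j <;>
    simp [commutingParam, matrixOfCoords, Fin.sum_univ_two] <;> ring

theorem tracelessCoords_mul_comm {A : Type*} [CommRing A] {a b : Fin 2 × Fin 2 → A}
    (h : ∀ i j, ∑ k, (a (i, k) * b (k, j) - b (i, k) * a (k, j)) = 0) (i j : Fin 3) :
    tracelessCoords a i * tracelessCoords b j = tracelessCoords a j * tracelessCoords b i := by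
  have h₀ := h 0 0
  have h₁ := h 0 1
  have h₂ := h 1 0
  rw [Fin.sum_univ_two] at h₀ h₁ h₂
  fin_cases i <;> fin_cases j <;> simp [tracelessCoords] <;> grind

theorem span_range_eq_span_tracelessCoords {K A : Type*} [CommRing K] [CommRing A] [Algebra K A]
    (a b : Fin 2 × Fin 2 → A) :
    Submodule.span K (Set.range (Sum.elim a b)) =
      Submodule.span K (Set.range (tracelessCoords a) ∪ Set.range (tracelessCoords b) ∪
        {a (1, 1), b (1, 1)}) := by
  apply le_antisymm
  · rw [Submodule.span_le]
    set S := Submodule.span K (Set.range (tracelessCoords a) ∪ Set.range (tracelessCoords b) ∪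
        {a (1, 1), b (1, 1)})
    have ha (i : Fin 3) : tracelessCoords a i ∈ S := Submodule.subset_span (by simp)
    have hb (i : Fin 3) : tracelessCoords b i ∈ S := Submodule.subset_span (by simp)
    have hx : a (1, 1) ∈ S := Submodule.subset_span (by simp)
    have hy : b (1, 1) ∈ S := Submodule.subset_span (by simp)
    have ha' : a (0, 0) ∈ S := by simpa [tracelessCoords] using S.add_mem (ha 2) hx
    have hb' : b (0, 0) ∈ S := by simpa [tracelessCoords] using S.add_mem (hb 2) hy
    rintro _ ⟨⟨i, j⟩ | ⟨i, j⟩, rfl⟩ <;> fin_cases i <;> fin_cases j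
    exacts [ha', ha 0, ha 1, hx, hb', hb 0, hb 1, hy]
  · rw [Submodule.span_le]
    have ha (i : Fin 2 × Fin 2) : a i ∈ Submodule.span K (Set.range (Sum.elim a b)) :=
      Submodule.subset_span ⟨Sum.inl i, rfl⟩
    have hb (i : Fin 2 × Fin 2) : b i ∈ Submodule.span K (Set.range (Sum.elim a b)) :=
      Submodule.subset_span ⟨Sum.inr i, rfl⟩
    rintro _ ((⟨i, rfl⟩ | ⟨i, rfl⟩) | rfl | rfl)
    · fin_cases i
      exacts [ha _, ha _, Submodule.sub_mem _ (ha _) (ha _)]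
    · fin_cases i
      exacts [hb _, hb _, Submodule.sub_mem _ (hb _) (hb _)]
    · exact ha _
    · exact hb _

theorem gradedPieceDim_commutatorIdeal (t : ℕ) :
    gradedPieceDim commutatorIdeal t = Fintype.card (SegreIndex (Fin 3) t) := by
  set π := Ideal.Quotient.mkₐ ℂ commutatorIdeal
  set a : Fin 2 × Fin 2 → _ := fun i => π (X (Sum.inl i)) with ha
  set b : Fin 2 × Fin 2 → _ := fun i => π (X (Sum.inr i)) with hb
  have hcomm (i j : Fin 2) : ∑ k, (a (i, k) * b (k, j) - b (i, k) * a (k, j)) = 0 := by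
    have : π (∑ k : Fin 2, (X (Sum.inl (i, k)) * X (Sum.inr (k, j)) -
        X (Sum.inr (i, k)) * X (Sum.inl (k, j)))) = 0 :=
      Ideal.Quotient.eq_zero_iff_mem.2 (Ideal.subset_span ⟨(i, j), rfl⟩)
    simpa only [map_sum, map_sub, map_mul] using this
  let ψ := Ideal.Quotient.liftₐ commutatorIdeal commutingParam
    fun _ => commutingParam_eq_zero_of_mem
  have hψ (f : MvPolynomial MatrixPairVar ℂ) : ψ (π f) = commutingParam f := rfl
  rw [gradedPieceDim, ← homogeneousSubmodule_one_pow, Submodule.map_pow,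
    homogeneousSubmodule_one_eq_span_X, Submodule.map_span, ← Set.range_comp]
  have hfun : (π.toLinearMap ∘ X : MatrixPairVar → _) = Sum.elim a b := by
    ext1 (i | i) <;> rfl
  rw [hfun, span_range_eq_span_tracelessCoords]
  refine finrank_span_pow_eq_card (tracelessCoords_mul_comm hcomm) ψ ?_ ?_ ?_ ?_ t
  · intro i
    fin_cases i <;> simp [tracelessCoords, ha, hψ, commutingParam, matrixOfCoords]
  · intro i
    fin_cases i <;> simp [tracelessCoords, hb, hψ, commutingParam, matrixOfCoords]
  · simp [ha, hψ, commutingParam, matrixOfCoords]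
  · simp [hb, hψ, commutingParam, matrixOfCoords]

/-- The commuting variety `C_2`, cut out by the entries of `AB - BA` for
generic `2×2` matrices `A` (variables `Sum.inl (i,j)`) and `B` (variables `Sum.inr (i,j)`),
has degree `3`. -/
theorem degree_commuting_variety_two :
    VarietyHasDegree
      (Ideal.span (Set.range fun p : Fin 2 × Fin 2 =>
        ∑ k : Fin 2,
          ((MvPolynomial.X (Sum.inl (p.1, k)) * MvPolynomial.X (Sum.inr (k, p.2)) -
            MvPolynomial.X (Sum.inr (p.1, k)) * MvPolynomial.X (Sum.inl (k, p.2))) :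
            MvPolynomial ((Fin 2 × Fin 2) ⊕ (Fin 2 × Fin 2)) ℂ)))
      3 := by
  let M : Polynomial ℚ :=
    (.X + .C 1) * (.X + .C 2) * (.X + .C 3) * (.X + .C 4) * (.X + .C (5 / 3))
  have hM : M.Monic := by
    dsimp only [M]; monicity!
  have hdeg : M.natDegree = 5 := by
    dsimp only [M]; compute_degree!
  refine ⟨Polynomial.C (1 / 40) * M, ⟨0, fun t _ => ?_⟩, ?_⟩
  · rw [gradedPieceDim_commutatorIdeal, card_segreIndex_fin_three]
    simp only [M, Polynomial.eval_mul, Polynomial.eval_add, Polynomial.eval_X, Polynomial.eval_C]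
    ring
  · rw [Polynomial.natDegree_C_mul (by norm_num), Polynomial.leadingCoeff_mul, hM.leadingCoeff,
      Polynomial.leadingCoeff_C, hdeg]
    norm_num [Nat.factorial]
end

section
/- Let R = C[a_{ij}, b_{ij} : 1 ≤ i,j ≤ 3] and let I_3 be the ideal generated by the nine entries of the commutator AB - BA, where A = (a_{ij}) and B = (b_{ij}) are generic 3×3 matrices. Then the degree of the projective scheme defined by I_3 equals 31. -/
open MvPolynomial

section Nakayama

variable {K σ ι κ : Type*} [Field K]

attribute [local instance] MvPolynomial.gradedAlgebra in
/-- Multiplication by a form of degree `n` shifts homogeneous components by `n`. -/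
lemma homogeneousComponent_mul_of_isHomogeneous {p : MvPolynomial σ K} {n : ℕ}
    (hp : p.IsHomogeneous n) (q : MvPolynomial σ K) (d : ℕ) :
    homogeneousComponent d (p * q) =
      if n ≤ d then p * homogeneousComponent (d - n) q else 0 := by
  have h := DirectSum.coe_decompose_mul_of_left_mem (homogeneousSubmodule σ K) (i := n) (b := q) d
    ((mem_homogeneousSubmodule n p).2 hp)
  have key : ∀ (r : MvPolynomial σ K) (i : ℕ),
      ((DirectSum.decompose (homogeneousSubmodule σ K) r i : homogeneousSubmodule σ K i) :
        MvPolynomial σ K) = homogeneousComponent i r := fun r i =>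
    decomposition.decompose'_apply r i
  simpa only [key] using h

/-- The `K`-linear map sending a coefficient vector `s` to `∑ k, s k (θ) * E k`. -/
noncomputable def aevalCombination [Fintype κ] (θ : ι → MvPolynomial σ K)
    (E : κ → MvPolynomial σ K) : (κ → MvPolynomial ι K) →ₗ[K] MvPolynomial σ K :=
  ∑ k, LinearMap.mulRight K (E k) ∘ₗ (aeval θ).toLinearMap ∘ₗ LinearMap.proj k

lemma aevalCombination_apply [Fintype κ] (θ : ι → MvPolynomial σ K) (E : κ → MvPolynomial σ K)
    (s : κ → MvPolynomial ι K) : aevalCombination θ E s = ∑ k, aeval θ (s k) * E k := by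
  simp [aevalCombination]

lemma aevalCombination_single [Fintype κ] [DecidableEq κ] (θ : ι → MvPolynomial σ K)
    (E : κ → MvPolynomial σ K) (k : κ) (p : MvPolynomial ι K) :
    aevalCombination θ E (Pi.single k p) = aeval θ p * E k := by
  rw [aevalCombination_apply, Finset.sum_eq_single k]
  · simp
  · intro j _ hj
    simp [Pi.single_eq_of_ne hj]
  · simp

lemma aevalCombination_mul [Fintype κ] (θ : ι → MvPolynomial σ K) (E : κ → MvPolynomial σ K)
    (p : MvPolynomial ι K) (s : κ → MvPolynomial ι K) :
    aevalCombination θ E (fun k => p * s k) = aeval θ p * aevalCombination θ E s := by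
  simp [aevalCombination_apply, Finset.mul_sum, mul_assoc]

/-- Graded Nakayama lemma: if the homogeneous elements `E` span `M` modulo `θ M + L` over the
ground field, then they span `M` modulo `L` over the subalgebra generated by `θ`. -/
lemma le_range_aevalCombination_sup [Fintype κ] {θ : ι → MvPolynomial σ K} {w : ι → ℕ}
    (hθ : ∀ i, (θ i).IsHomogeneous (w i)) (hw : ∀ i, 0 < w i)
    {E : κ → MvPolynomial σ K} {dg : κ → ℕ} (hE : ∀ k, (E k).IsHomogeneous (dg k))
    {M L : Ideal (MvPolynomial σ K)}
    (hL : letI := MvPolynomial.gradedAlgebra (σ := σ) (R := K)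
      L.IsHomogeneous (homogeneousSubmodule σ K))
    (h : M.restrictScalars K ≤ Submodule.span K (Set.range E) ⊔
      (Ideal.span (Set.range θ) * M ⊔ L).restrictScalars K) :
    M.restrictScalars K ≤ LinearMap.range (aevalCombination θ E) ⊔ L.restrictScalars K := by
  classical
  set P := LinearMap.range (aevalCombination θ E) ⊔ L.restrictScalars K with hP
  have hEP : ∀ k, E k ∈ P := fun k => Submodule.mem_sup_left
    ⟨Pi.single k 1, by rw [aevalCombination_single]; simp⟩
  have hθP : ∀ i, ∀ x ∈ P, θ i * x ∈ P := by
    intro i x hx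
    obtain ⟨_, ⟨s, rfl⟩, l, hl, rfl⟩ := Submodule.mem_sup.1 hx
    rw [mul_add]
    refine Submodule.add_mem_sup ⟨fun k => X i * s k, ?_⟩ (L.mul_mem_left _ hl)
    rw [aevalCombination_mul, aeval_X]
  have key : ∀ d, ∀ x ∈ M, homogeneousComponent d x ∈ P := by
    intro d
    induction d using Nat.strong_induction_on with
    | _ d ih =>
      have hmul : ∀ r ∈ Ideal.span (Set.range θ), ∀ m ∈ M,
          homogeneousComponent d (r * m) ∈ P := by
        intro r hr
        induction hr using Submodule.span_induction with
        | mem r hr =>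
          obtain ⟨i, rfl⟩ := hr
          intro m hm
          rw [homogeneousComponent_mul_of_isHomogeneous (hθ i)]
          split_ifs with hid
          · exact hθP i _ (ih _ (by have := hw i; omega) m hm)
          · exact P.zero_mem
        | zero => simp
        | add r r' _ _ h1 h2 =>
          intro m hm
          rw [add_mul, map_add]
          exact P.add_mem (h1 m hm) (h2 m hm)
        | smul a r _ h1 =>
          intro m hm
          rw [smul_eq_mul, mul_comm a, mul_assoc]
          exact h1 _ (M.mul_mem_left _ hm)
      intro x hx
      obtain ⟨y, hy, r, hr, rfl⟩ := Submodule.mem_sup.1 (h hx)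
      obtain ⟨t, ht, l, hl, rfl⟩ := Submodule.mem_sup.1 (show r ∈ _ ⊔ L from hr)
      rw [map_add, map_add]
      refine P.add_mem ?_ (P.add_mem ?_ ?_)
      · have : Submodule.span K (Set.range E) ≤ P.comap (homogeneousComponent d) := by
          rw [Submodule.span_le]
          rintro _ ⟨k, rfl⟩
          change homogeneousComponent d (E k) ∈ P
          rw [homogeneousComponent_of_mem (hE k)]
          split_ifs
          · exact hEP k
          · exact P.zero_mem
        exact this hy
      · have : (Ideal.span (Set.range θ) * M).restrictScalars K ≤
            P.comap (homogeneousComponent d) := fun t ht =>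
          Submodule.mul_induction_on (show t ∈ Ideal.span (Set.range θ) * M from ht) hmul
            fun a b ha hb => Submodule.add_mem _ ha hb
        exact this ht
      · exact Submodule.mem_sup_right (homogeneousComponent_mem_of_mem hL hl d)
  intro x hx
  rw [← sum_homogeneousComponent x]
  exact P.sum_mem fun d _ => key d x hx

/-- If the span of `E` modulo `θ M + L` contains generators of `M` and is stable under
multiplication by `z`, where `z` and `θ` generate all variables, then it contains `M`. -/
lemma le_span_sup_of_mul_mem {ι' : Type*} {θ : ι → MvPolynomial σ K} {z : ι' → MvPolynomial σ K}
    (hX : ∀ s, (X s : MvPolynomial σ K) ∈ Submodule.span K (Set.range z) ⊔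
      (Ideal.span (Set.range θ)).restrictScalars K)
    {E : κ → MvPolynomial σ K} {G : Set (MvPolynomial σ K)} {L : Ideal (MvPolynomial σ K)}
    (hL : L ≤ Ideal.span G) (hE : ∀ k, E k ∈ Ideal.span G)
    (hG : ∀ g ∈ G, g ∈ Submodule.span K (Set.range E) ⊔
      (Ideal.span (Set.range θ) * Ideal.span G ⊔ L).restrictScalars K)
    (hz : ∀ j k, z j * E k ∈ Submodule.span K (Set.range E) ⊔
      (Ideal.span (Set.range θ) * Ideal.span G ⊔ L).restrictScalars K) :
    (Ideal.span G).restrictScalars K ≤ Submodule.span K (Set.range E) ⊔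
      (Ideal.span (Set.range θ) * Ideal.span G ⊔ L).restrictScalars K := by
  set N := Ideal.span (Set.range θ) * Ideal.span G ⊔ L with hN
  set P := Submodule.span K (Set.range E) ⊔ N.restrictScalars K with hP
  have hPM : P ≤ (Ideal.span G).restrictScalars K := by
    refine sup_le (Submodule.span_le.2 ?_) ?_
    · rintro _ ⟨k, rfl⟩
      exact hE k
    · exact fun x hx => (sup_le Ideal.mul_le_right hL : N ≤ _) hx
  have hzP : ∀ r ∈ Submodule.span K (Set.range z), ∀ x ∈ P, r * x ∈ P := by
    intro r hr x hx
    induction hr using Submodule.span_induction with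
    | mem r hr =>
      obtain ⟨j, rfl⟩ := hr
      obtain ⟨y, hy, n, hn, rfl⟩ := Submodule.mem_sup.1 hx
      rw [mul_add]
      refine P.add_mem ?_ (Submodule.mem_sup_right (N.mul_mem_left _ hn))
      have : Submodule.span K (Set.range E) ≤ P.comap (LinearMap.mulLeft K (z j)) := by
        rw [Submodule.span_le]
        rintro _ ⟨k, rfl⟩
        exact hz j k
      exact this hy
    | zero => simp
    | add r r' _ _ h1 h2 =>
      rw [add_mul]
      exact P.add_mem h1 h2
    | smul a r _ h1 =>
      rw [smul_mul_assoc]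
      exact P.smul_mem _ h1
  have hXP : ∀ s, ∀ x ∈ P, X s * x ∈ P := by
    intro s x hx
    obtain ⟨y, hy, t, ht, hyt⟩ := Submodule.mem_sup.1 (hX s)
    rw [← hyt, add_mul]
    exact P.add_mem (hzP y hy x hx)
      (Submodule.mem_sup_right (Submodule.mem_sup_left (Ideal.mul_mem_mul ht (hPM hx))))
  have hR : ∀ r : MvPolynomial σ K, ∀ x ∈ P, r * x ∈ P := by
    intro r
    induction r using MvPolynomial.induction_on with
    | C a =>
      intro x hx
      rw [← smul_eq_C_mul]
      exact P.smul_mem _ hx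
    | add p q hp hq =>
      intro x hx
      rw [add_mul]
      exact P.add_mem (hp x hx) (hq x hx)
    | mul_X p s hp =>
      intro x hx
      rw [mul_assoc]
      exact hp _ (hXP s x hx)
  exact fun x hx => Submodule.span_induction (p := fun x _ => x ∈ P) hG P.zero_mem
    (fun _ _ _ _ => P.add_mem) (fun a x _ => hR a x) hx

/-- A surjective `aevalCombination` between graded spaces of the same size is injective. -/
lemma aevalCombination_injective [Finite σ] [Fintype κ] {θ : ι → MvPolynomial σ K} {w : ι → ℕ}
    (hθ : ∀ i, (θ i).IsHomogeneous (w i))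
    {E : κ → MvPolynomial σ K} {dg : κ → ℕ} (hE : ∀ k, (E k).IsHomogeneous (dg k))
    (η : (κ × (ι →₀ ℕ)) ≃ (σ →₀ ℕ))
    (hη : ∀ k m, (η (k, m)).degree = m.sum (fun i n => n * w i) + dg k)
    (hsurj : Function.Surjective (aevalCombination θ E)) :
    Function.Injective (aevalCombination θ E) := by
  classical
  let B := (Pi.basis fun _ : κ => basisMonomials ι K).reindex ((Equiv.sigmaEquivProd _ _).trans η)
  let e : MvPolynomial σ K ≃ₗ[K] (κ → MvPolynomial ι K) :=
    (basisMonomials σ K).equiv B (Equiv.refl _)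
  let Ψ : MvPolynomial σ K →ₗ[K] MvPolynomial σ K := aevalCombination θ E ∘ₗ e.toLinearMap
  have hΨmon : ∀ m, (Ψ (monomial m 1)).IsHomogeneous m.degree := by
    intro m
    obtain ⟨⟨k, m⟩, rfl⟩ := η.surjective m
    have : e (monomial (η (k, m)) 1) = Pi.single k (monomial m 1) := by
      have := (basisMonomials σ K).equiv_apply (η (k, m)) B (Equiv.refl _)
      rw [coe_basisMonomials] at this
      rw [this]
      simp [B]
    change (aevalCombination θ E (e _)).IsHomogeneous _
    rw [this, aevalCombination_single, hη, aeval_monomial, map_one, one_mul]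
    refine IsHomogeneous.mul ?_ (hE k)
    refine IsHomogeneous.prod _ _ _ fun i _ => ?_
    simpa only [mul_comm] using (hθ i).pow (m i)
  have hcomm : ∀ d x, Ψ (homogeneousComponent d x) = homogeneousComponent d (Ψ x) := by
    intro d
    suffices h : Ψ ∘ₗ homogeneousComponent d = homogeneousComponent d ∘ₗ Ψ from
      fun x => LinearMap.congr_fun h x
    refine (basisMonomials σ K).ext fun m => ?_
    rw [coe_basisMonomials]
    simp only [LinearMap.comp_apply]
    rw [homogeneousComponent_of_mem (hΨmon m),
      homogeneousComponent_of_mem (isHomogeneous_monomial (1 : K) rfl)]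
    split_ifs <;> simp
  have hΨsurj : Function.Surjective Ψ := hsurj.comp e.surjective
  have hmaps : ∀ d, ∀ x ∈ homogeneousSubmodule σ K d, Ψ x ∈ homogeneousSubmodule σ K d := by
    intro d x hx
    rw [← homogeneousComponent_eq_self hx, hcomm]
    exact homogeneousComponent_mem d _
  have hinj : ∀ d, ∀ x ∈ homogeneousSubmodule σ K d, Ψ x = 0 → x = 0 := by
    intro d x hx hx0
    have : Module.Finite K (homogeneousSubmodule σ K d) :=
      Module.Finite.iff_fg.2 (homogeneousSubmodule_fg σ K d)
    have hs : Function.Surjective (Ψ.restrict (hmaps d)) := by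
      rintro ⟨y, hy⟩
      obtain ⟨x, rfl⟩ := hΨsurj y
      refine ⟨⟨homogeneousComponent d x, homogeneousComponent_mem d x⟩, Subtype.ext ?_⟩
      change Ψ (homogeneousComponent d x) = Ψ x
      rw [hcomm, homogeneousComponent_eq_self hy]
    have hi := LinearMap.injective_iff_surjective.2 hs
    have : (⟨x, hx⟩ : homogeneousSubmodule σ K d) = 0 := hi (Subtype.ext (by simpa using hx0))
    exact congrArg Subtype.val this
  have hΨinj : Function.Injective Ψ := by
    rw [injective_iff_map_eq_zero]
    intro x hx
    rw [← sum_homogeneousComponent x]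
    refine Finset.sum_eq_zero fun d _ => hinj d _ (homogeneousComponent_mem d x) ?_
    rw [hcomm, hx, map_zero]
  intro s t hst
  have := hΨinj (a₁ := e.symm s) (a₂ := e.symm t) (by simpa [Ψ] using hst)
  exact e.symm.injective this

end Nakayama

section HilbertFunction

variable {K σ ι φ κ κ' : Type*} [Field K]

/-- Substituting linear forms commutes with taking homogeneous components. -/
lemma homogeneousComponent_aeval {θ : ι → MvPolynomial σ K} (hθ : ∀ i, (θ i).IsHomogeneous 1)
    (d : ℕ) (p : MvPolynomial ι K) :
    homogeneousComponent d (aeval θ p) = aeval θ (homogeneousComponent d p) := by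
  suffices h : homogeneousComponent d ∘ₗ (aeval θ).toLinearMap =
      (aeval θ).toLinearMap ∘ₗ homogeneousComponent d from LinearMap.congr_fun h p
  refine (basisMonomials ι K).ext fun m => ?_
  have hm : (monomial m (1 : K)).IsHomogeneous m.degree := isHomogeneous_monomial _ rfl
  have hm' : (aeval θ (monomial m (1 : K))).IsHomogeneous m.degree := by
    simpa using hm.aeval θ hθ
  rw [coe_basisMonomials]
  simp only [LinearMap.comp_apply, AlgHom.toLinearMap_apply]
  rw [homogeneousComponent_of_mem hm, homogeneousComponent_of_mem hm']
  split_ifs <;> simp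

lemma homogeneousComponent_aevalCombination [Fintype κ] {θ : ι → MvPolynomial σ K}
    (hθ : ∀ i, (θ i).IsHomogeneous 1) {E : κ → MvPolynomial σ K} {dg : κ → ℕ}
    (hE : ∀ k, (E k).IsHomogeneous (dg k)) {t : ℕ} (ht : ∀ k, dg k ≤ t)
    (s : κ → MvPolynomial ι K) :
    homogeneousComponent t (aevalCombination θ E s) =
      aevalCombination θ E fun k => homogeneousComponent (t - dg k) (s k) := by
  simp only [aevalCombination_apply, map_sum]
  refine Finset.sum_congr rfl fun k _ => ?_
  rw [mul_comm, homogeneousComponent_mul_of_isHomogeneous (hE k), if_pos (ht k),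
    homogeneousComponent_aeval hθ, mul_comm]

/-- The space of forms of degree `n` in `m + 1` variables has dimension `(n + m).choose m`. -/
lemma finrank_homogeneousSubmodule_fin (m n : ℕ) :
    Module.finrank K (homogeneousSubmodule (Fin (m + 1)) K n) = (n + m).choose m := by
  rw [homogeneousSubmodule_eq_finsupp_supported]
  have hset : {d : Fin (m + 1) →₀ ℕ | d.degree = n} =
      ((Finset.univ : Finset (Fin (m + 1))).finsuppAntidiag n : Finset _) := by
    ext d
    simp [Finset.mem_finsuppAntidiag, Finsupp.degree_eq_sum]
  rw [(AddMonoidAlgebra.supportedEquivFinsupp _).finrank_eq, hset, Module.finrank_finsupp_self,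
    ← Nat.card_eq_fintype_card, Nat.card_coe_set_eq, Set.ncard_coe_finset,
    Finset.card_finsuppAntidiag_nat_eq_choose, Finset.card_fin,
    show m + 1 + n - 1 = n + m by omega, Nat.choose_symm_add]

/-- Suppose that `R / I` is spanned by `E` modulo linear forms `θ`, that `I / (f)` is spanned by
`E'` modulo `θ`, and that the total number of elements of `E` and `E'` in each degree is that of a
complete intersection of type `f`. Then `R / I` is free over `K[θ]` with basis `E`. -/
lemma mk_comp_aevalCombination_bijective [Finite σ] [Fintype κ] [Fintype κ']
    {θ : ι → MvPolynomial σ K} (hθ : ∀ i, (θ i).IsHomogeneous 1)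
    {f : φ → MvPolynomial σ K} (hf : ∀ i, (f i).IsHomogeneous 2)
    {E : κ → MvPolynomial σ K} {dg : κ → ℕ} (hE : ∀ k, (E k).IsHomogeneous (dg k))
    {E' : κ' → MvPolynomial σ K} {dg' : κ' → ℕ} (hE' : ∀ k, (E' k).IsHomogeneous (dg' k))
    {I : Ideal (MvPolynomial σ K)}
    (hI : letI := MvPolynomial.gradedAlgebra (σ := σ) (R := K)
      I.IsHomogeneous (homogeneousSubmodule σ K))
    (h : ⊤ ≤ Submodule.span K (Set.range E) ⊔
      (Ideal.span (Set.range θ) ⊔ I).restrictScalars K)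
    (h' : I.restrictScalars K ≤ Submodule.span K (Set.range E') ⊔
      (Ideal.span (Set.range θ) * I ⊔ Ideal.span (Set.range f)).restrictScalars K)
    (η : ((κ ⊕ κ') × (ι ⊕ φ →₀ ℕ)) ≃ (σ →₀ ℕ))
    (hη : ∀ k m, (η (k, m)).degree =
      m.sum (fun i n => n * Sum.elim (fun _ => 1) (fun _ => 2) i) + Sum.elim dg dg' k) :
    Function.Bijective
      ((Ideal.Quotient.mkₐ K I).toLinearMap ∘ₗ aevalCombination θ E) := by
  classical
  let := MvPolynomial.gradedAlgebra (σ := σ) (R := K)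
  have hθf : ∀ i, (Sum.elim θ f i).IsHomogeneous
      (Sum.elim (fun _ => 1) (fun _ => 2) i : ℕ) := by
    rintro (i | i)
    exacts [hθ i, hf i]
  have hEE' : ∀ k, (Sum.elim E E' k).IsHomogeneous (Sum.elim dg dg' k) := by
    rintro (k | k)
    exacts [hE k, hE' k]
  have hF : (Ideal.span (Set.range f)).IsHomogeneous (homogeneousSubmodule σ K) :=
    Ideal.homogeneous_span _ _ (by rintro _ ⟨i, rfl⟩; exact ⟨2, hf i⟩)
  have hsurjI := le_range_aevalCombination_sup (M := ⊤) hθ (fun _ => one_pos) hE hI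
    (by simpa using h)
  have hsurjF := le_range_aevalCombination_sup hθ (fun _ => one_pos) hE' hF h'
  have hsurj : Function.Surjective (aevalCombination (Sum.elim θ f) (Sum.elim E E')) := by
    rw [← LinearMap.range_eq_top, eq_top_iff]
    have := le_range_aevalCombination_sup (M := ⊤) (L := ⊥) hθf (by rintro (i | i) <;> simp) hEE'
      (Ideal.IsHomogeneous.bot _) ?_
    · simpa using this
    · have hθ' : Ideal.span (Set.range θ) ≤ Ideal.span (Set.range (Sum.elim θ f)) :=
        Ideal.span_mono (by rw [Set.Sum.elim_range]; exact Set.subset_union_left)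
      have hf' : Ideal.span (Set.range f) ≤ Ideal.span (Set.range (Sum.elim θ f)) :=
        Ideal.span_mono (by rw [Set.Sum.elim_range]; exact Set.subset_union_right)
      have h1 : Submodule.span K (Set.range E) ≤
          Submodule.span K (Set.range (Sum.elim E E')) :=
        Submodule.span_mono (by rw [Set.Sum.elim_range]; exact Set.subset_union_left)
      have h2 : Submodule.span K (Set.range E') ≤
          Submodule.span K (Set.range (Sum.elim E E')) :=
        Submodule.span_mono (by rw [Set.Sum.elim_range]; exact Set.subset_union_right)
      rw [Ideal.mul_top, sup_bot_eq]
      rintro x -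
      obtain ⟨y, hy, r, hr, rfl⟩ := Submodule.mem_sup.1 (h (Submodule.mem_top : x ∈ ⊤))
      obtain ⟨u, hu, v, hv, rfl⟩ := Submodule.mem_sup.1
        (show r ∈ Ideal.span (Set.range θ) ⊔ I from hr)
      obtain ⟨y', hy', r', hr', rfl⟩ := Submodule.mem_sup.1 (h' hv)
      have hr'' : r' ∈ Ideal.span (Set.range (Sum.elim θ f)) :=
        (sup_le (Ideal.mul_le_left.trans hθ') hf' :
          Ideal.span (Set.range θ) * I ⊔ Ideal.span (Set.range f) ≤
            Ideal.span (Set.range (Sum.elim θ f))) hr'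
      have hru : u + r' ∈ (Ideal.span (Set.range (Sum.elim θ f))).restrictScalars K :=
        Ideal.add_mem _ (hθ' hu) hr''
      rw [show y + (u + (y' + r')) = (y + y') + (u + r') by ring]
      exact Submodule.add_mem_sup (Submodule.add_mem _ (h1 hy) (h2 hy')) hru
  have hinj := aevalCombination_injective hθf hEE' η hη hsurj
  constructor
  · rw [injective_iff_map_eq_zero]
    intro s hs
    have hsI : aevalCombination θ E s ∈ I := by
      simpa [Ideal.Quotient.eq_zero_iff_mem] using hs
    obtain ⟨_, ⟨s', rfl⟩, r, hr, hsum⟩ := Submodule.mem_sup.1 (hsurjF hsI)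
    have hF' : ∀ r ∈ Ideal.span (Set.range f), ∀ c, ∃ q : κ ⊕ κ' → MvPolynomial (ι ⊕ φ) K,
        aevalCombination (Sum.elim θ f) (Sum.elim E E') q = c * r ∧
          ∀ k, aeval (Sum.elim X 0 : ι ⊕ φ → MvPolynomial ι K) (q k) = 0 := by
      intro r hr
      induction hr using Submodule.span_induction with
      | mem r hr =>
        obtain ⟨i, rfl⟩ := hr
        intro c
        obtain ⟨q, hq⟩ := hsurj c
        refine ⟨fun k => X (Sum.inr i) * q k, ?_, fun k => by simp⟩
        rw [aevalCombination_mul, hq, aeval_X, Sum.elim_inr, mul_comm]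
      | zero => exact fun c => ⟨0, by simp, by simp⟩
      | add r r' _ _ h1 h2 =>
        intro c
        obtain ⟨q, hq, hq0⟩ := h1 c
        obtain ⟨q', hq', hq0'⟩ := h2 c
        exact ⟨q + q', by rw [map_add, hq, hq', mul_add], fun k => by
          rw [Pi.add_apply, map_add, hq0, hq0', add_zero]⟩
      | smul a r _ h1 =>
        intro c
        rw [smul_eq_mul, ← mul_assoc]
        exact h1 _
    obtain ⟨q, hqr, hq⟩ := hF' r hr 1
    rw [one_mul] at hqr
    have heq : (Sum.elim (fun k => rename Sum.inl (s k)) (fun k => - rename Sum.inl (s' k)) :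
        κ ⊕ κ' → MvPolynomial (ι ⊕ φ) K) = q := by
      apply hinj
      have : aevalCombination (Sum.elim θ f) (Sum.elim E E')
          (Sum.elim (fun k => rename Sum.inl (s k)) (fun k => - rename Sum.inl (s' k))) =
            aevalCombination θ E s - aevalCombination θ E' s' := by
        simp [aevalCombination_apply, bind₁_rename, sub_eq_add_neg]
      rw [this, hqr, ← hsum, add_sub_cancel_left]
    funext k
    have := hq (Sum.inl k)
    rw [← heq] at this
    simpa [bind₁_rename, bind₁_X_left] using this
  · intro x
    obtain ⟨x, rfl⟩ := Ideal.Quotient.mk_surjective x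
    obtain ⟨_, ⟨s, rfl⟩, r, hr, rfl⟩ := Submodule.mem_sup.1 (hsurjI (Submodule.mem_top : x ∈ ⊤))
    refine ⟨s, ?_⟩
    have : Ideal.Quotient.mk I r = 0 := Ideal.Quotient.eq_zero_iff_mem.2 hr
    simp [this]

/-- The Hilbert function of a quotient that is free over a polynomial ring in `m + 1` linear forms,
with a homogeneous basis `E`. -/
lemma finrank_map_homogeneousSubmodule [Fintype κ] {m : ℕ}
    {θ : Fin (m + 1) → MvPolynomial σ K} (hθ : ∀ i, (θ i).IsHomogeneous 1)
    {E : κ → MvPolynomial σ K} {dg : κ → ℕ} (hE : ∀ k, (E k).IsHomogeneous (dg k))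
    {I : Ideal (MvPolynomial σ K)}
    (hI : letI := MvPolynomial.gradedAlgebra (σ := σ) (R := K)
      I.IsHomogeneous (homogeneousSubmodule σ K))
    (hbij : Function.Bijective
      ((Ideal.Quotient.mkₐ K I).toLinearMap ∘ₗ aevalCombination θ E))
    {t : ℕ} (ht : ∀ k, dg k ≤ t) :
    Module.finrank K ((homogeneousSubmodule σ K t).map (Ideal.Quotient.mkₐ K I).toLinearMap) =
      ∑ k, (t - dg k + m).choose m := by
  let ℓ : (∀ k, homogeneousSubmodule (Fin (m + 1)) K (t - dg k)) →ₗ[K]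
      (κ → MvPolynomial (Fin (m + 1)) K) :=
    LinearMap.pi fun k => (homogeneousSubmodule (Fin (m + 1)) K (t - dg k)).subtype ∘ₗ
      LinearMap.proj k
  have hℓ : Function.Injective ℓ := fun x y hxy => by
    funext k
    exact Subtype.ext (congrFun hxy k)
  have hrange : (homogeneousSubmodule σ K t).map (Ideal.Quotient.mkₐ K I).toLinearMap =
      LinearMap.range (((Ideal.Quotient.mkₐ K I).toLinearMap ∘ₗ aevalCombination θ E) ∘ₗ ℓ) := by
    apply le_antisymm
    · rintro _ ⟨x, hx, rfl⟩
      obtain ⟨s, hs⟩ := hbij.2 (Ideal.Quotient.mkₐ K I x)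
      refine ⟨fun k => ⟨homogeneousComponent (t - dg k) (s k), homogeneousComponent_mem _ _⟩, ?_⟩
      have hmem : aevalCombination θ E s - x ∈ I := Ideal.Quotient.eq.1 hs
      have := homogeneousComponent_mem_of_mem hI hmem t
      rw [map_sub, homogeneousComponent_aevalCombination hθ hE ht,
        homogeneousComponent_eq_self hx] at this
      exact Ideal.Quotient.eq.2 this
    · rintro _ ⟨s, rfl⟩
      refine ⟨aevalCombination θ E (ℓ s), ?_, rfl⟩
      have : aevalCombination θ E (ℓ s) = homogeneousComponent t (aevalCombination θ E (ℓ s)) := by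
        rw [homogeneousComponent_aevalCombination hθ hE ht]
        congr 1
        funext k
        exact (homogeneousComponent_eq_self (s k).2).symm
      rw [this]
      exact homogeneousComponent_mem _ _
  rw [hrange, LinearMap.finrank_range_of_inj (by
    rw [LinearMap.coe_comp]
    exact hbij.1.comp hℓ)]
  have : ∀ k, Module.Finite K (homogeneousSubmodule (Fin (m + 1)) K (t - dg k)) := fun k =>
    Module.Finite.iff_fg.2 (homogeneousSubmodule_fg _ K _)
  rw [Module.finrank_pi_fintype]
  exact Finset.sum_congr rfl fun k _ => finrank_homogeneousSubmodule_fin m _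

end HilbertFunction

section Words

variable {Q ι τ : Type*} [CommRing Q]

/-- The product of the letters of a word, evaluated at `z`, times a generator. -/
def wordTerm (z : ι → Q) (x : τ → Q) (p : List ι × τ) : Q := (p.1.map z).prod * x p.2

/-- Multiplying a word of `S` by a letter gives a word of `S`, or a multiple of the left-hand side
of a rewriting rule such that the corresponding multiple of the right-hand side only involves words
of `S`. -/
def RulesClosed [DecidableEq ι] (S : List (List ι × τ))
    (rules : List ((List ι × τ) × List (ℤ × List ι × τ))) : Prop :=
  ∀ j, ∀ p ∈ S, (∃ q ∈ S, (j :: p.1).Perm q.1 ∧ p.2 = q.2) ∨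
    ∃ r ∈ rules, (r.1.1 ++ (j :: p.1).diff r.1.1).Perm (j :: p.1) ∧ p.2 = r.1.2 ∧
      ∀ t ∈ r.2, ∃ q ∈ S, ((j :: p.1).diff r.1.1 ++ t.2.1).Perm q.1 ∧ t.2.2 = q.2

instance [Fintype ι] [DecidableEq ι] [DecidableEq τ] (S : List (List ι × τ))
    (rules : List ((List ι × τ) × List (ℤ × List ι × τ))) : Decidable (RulesClosed S rules) := by
  unfold RulesClosed
  infer_instance

lemma wordTerm_append (z : ι → Q) (x : τ → Q) (l l' : List ι) (i : τ) :
    wordTerm z x (l ++ l', i) = (l.map z).prod * wordTerm z x (l', i) := by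
  simp [wordTerm, mul_assoc]

lemma wordTerm_perm (z : ι → Q) (x : τ → Q) {l l' : List ι} (h : l.Perm l') (i : τ) :
    wordTerm z x (l, i) = wordTerm z x (l', i) := by
  simp only [wordTerm, (h.map z).prod_eq]

lemma mul_wordTerm_mem_span (K : Type*) [CommRing K] [Algebra K Q] [DecidableEq ι]
    {z : ι → Q} {x : τ → Q} {S : List (List ι × τ)}
    {rules : List ((List ι × τ) × List (ℤ × List ι × τ))} (hS : RulesClosed S rules)
    (hr : ∀ r ∈ rules, wordTerm z x r.1 = (r.2.map fun t => t.1 • wordTerm z x t.2).sum)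
    (j : ι) {p : List ι × τ} (hp : p ∈ S) :
    z j * wordTerm z x p ∈ Submodule.span K (wordTerm z x '' {q | q ∈ S}) := by
  have hmem : ∀ {q}, q ∈ S → wordTerm z x q ∈ Submodule.span K (wordTerm z x '' {q | q ∈ S}) :=
    fun hq => Submodule.subset_span ⟨_, hq, rfl⟩
  have hcons : z j * wordTerm z x p = wordTerm z x (j :: p.1, p.2) := by
    simp [wordTerm, mul_assoc]
  rw [hcons]
  obtain ⟨q, hq, hperm, hpq⟩ | ⟨r, hrr, hperm, hpr, ht⟩ := hS j p hp
  · rw [wordTerm_perm z x hperm, hpq]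
    exact hmem hq
  · rw [← wordTerm_perm z x (List.perm_append_comm.trans hperm), wordTerm_append, hpr,
      show (r.1.1, r.1.2) = r.1 from rfl, hr r hrr, ← List.sum_map_mul_left]
    refine list_sum_mem fun y hy => ?_
    obtain ⟨t, htr, rfl⟩ := List.mem_map.1 hy
    obtain ⟨q, hq, hqt, hi⟩ := ht t htr
    rw [mul_smul_comm, ← wordTerm_append z x _ t.2.1 t.2.2, wordTerm_perm z x hqt, hi]
    exact zsmul_mem (hmem hq) _

end Words

/-- The words in `a, …, f` spanning the coordinate ring of the commuting scheme modulo the linear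
forms. -/
def quotientBasis : List (List (Fin 6) × Fin 1) :=
  [([], 0), ([0], 0), ([1], 0), ([2], 0), ([3], 0), ([4], 0), ([5], 0), ([0, 0], 0), ([0, 1], 0),
  ([0, 2], 0), ([0, 3], 0), ([0, 4], 0), ([0, 5], 0), ([1, 2], 0), ([1, 4], 0), ([2, 3], 0),
  ([2, 4], 0), ([3, 3], 0), ([3, 4], 0), ([3, 5], 0), ([0, 0, 0], 0), ([0, 0, 1], 0),
  ([0, 0, 2], 0), ([0, 0, 3], 0), ([0, 0, 4], 0), ([0, 0, 5], 0), ([0, 3, 3], 0), ([0, 3, 4], 0),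
  ([0, 3, 5], 0), ([2, 3, 4], 0), ([0, 0, 0, 0], 0)]

/-- Rewriting rules for the coordinate ring of the commuting scheme modulo the linear forms. -/
def quotientRules : List ((List (Fin 6) × Fin 1) × List (ℤ × List (Fin 6) × Fin 1)) :=
  [(([4, 4], 0), []), (([1, 3], 0), []), (([2, 5], 0), []),
  (([2, 2], 0), [(1, [0, 3], 0), (1, [1, 4], 0)]),
  (([1, 1], 0), [(1, [0, 5], 0), (1, [3, 4], 0)]),
  (([5, 5], 0), [(-1, [0, 0], 0), (1, [1, 2], 0)]),
  (([1, 5], 0), [(-1, [0, 4], 0), (1, [3, 3], 0)]), (([4, 5], 0), [(1, [0, 2], 0)]),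
  (([0, 2, 2], 0), []), (([0, 2, 4], 0), []), (([0, 1, 4], 0), [(-1, [0, 0, 3], 0)]),
  (([2, 2, 3], 0), [(1, [0, 3, 3], 0)]), (([2, 2, 4], 0), [(1, [0, 3, 4], 0)]),
  (([1, 4, 5], 0), [(-1, [0, 3, 5], 0)]), (([0, 1, 2], 0), [(-1, [0, 3, 5], 0)]),
  (([1, 1, 2], 0), [(1, [2, 3, 4], 0)]), (([3, 3, 4], 0), [(-1, [0, 3, 5], 0)]),
  (([0, 5, 5], 0), [(-1, [0, 0, 0], 0), (-1, [0, 3, 5], 0)]),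
  (([1, 2, 2], 0), [(1, [0, 0, 2], 0)]), (([3, 5, 5], 0), [(-1, [0, 0, 3], 0)]),
  (([1, 2, 4], 0), [(1, [0, 0, 4], 0)]), (([3, 3, 3], 0), [(1, [0, 3, 4], 0)]),
  (([1, 1, 4], 0), [(1, [0, 0, 2], 0)]),
  (([3, 4, 5], 0), [(1, [0, 0, 0], 0), (1, [0, 3, 5], 0), (1, [0, 0, 3], 0)]),
  (([0, 2, 3], 0), [(1, [0, 0, 0], 0), (1, [0, 3, 5], 0), (1, [0, 0, 3], 0)]),
  (([2, 3, 3], 0), []),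
  (([3, 3, 5], 0), [(-1, [0, 0, 1], 0), (1, [2, 3, 4], 0), (1, [0, 0, 2], 0)]),
  (([0, 0, 0, 2], 0), []), (([0, 0, 2, 3], 0), []), (([0, 0, 3, 3], 0), []),
  (([0, 3, 3, 3], 0), []), (([0, 3, 3, 5], 0), []), (([0, 0, 3, 4], 0), []),
  (([0, 3, 4, 5], 0), []), (([0, 0, 4, 5], 0), []), (([0, 3, 5, 5], 0), []),
  (([0, 0, 0, 3], 0), []), (([0, 0, 1, 4], 0), []), (([0, 0, 0, 4], 0), []),
  (([0, 0, 5, 5], 0), []), (([0, 0, 3, 5], 0), [(-1, [0, 0, 0, 0], 0)]),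
  (([0, 3, 3, 4], 0), [(1, [0, 0, 0, 0], 0)]), (([2, 2, 3, 4], 0), [(1, [0, 0, 0, 0], 0)]),
  (([0, 0, 1, 2], 0), [(1, [0, 0, 0, 0], 0)]), (([0, 0, 1, 5], 0), []),
  (([0, 0, 1, 1], 0), [(1, [0, 0, 0, 0], 0)]), (([0, 0, 0, 5], 0), [(1, [0, 0, 0, 0], 0)]),
  (([0, 0, 0, 1], 0), []), (([0, 0, 0, 0, 0], 0), []), (([0, 0, 0, 0, 5], 0), [])]

lemma quotientBasis_closed : RulesClosed quotientBasis quotientRules := by decide +kernel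

/-- The rewriting rules follow from the entries of the commutator. -/
lemma quotientRules_hold {Q : Type*} [CommRing Q] {a b c d e f : Q}
    (g00 : b * d + e * f - a * c = 0)
    (g01 : a * d + b * e - c^2 = 0)
    (g02 : e^2 = 0)
    (g10 : -a * f + b^2 - d * e = 0)
    (g11 : -b * d = 0)
    (g12 : c * f = 0)
    (g20 : -a^2 + b * c - f^2 = 0)
    (g21 : -a * e + d^2 - b * f = 0) :
    ∀ r ∈ quotientRules, wordTerm ![a, b, c, d, e, f] ![1] r.1 =
      (r.2.map fun t => t.1 • wordTerm ![a, b, c, d, e, f] ![1] t.2).sum := by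
  have hee : e^2 = 0 := by linear_combination g02
  have hbd : b * d = 0 := by linear_combination -g11
  have hcf : c * f = 0 := by linear_combination g12
  have hcc : c^2 = a * d + b * e := by linear_combination -g01
  have hbb : b^2 = a * f + d * e := by linear_combination g10
  have hff : f^2 = -a^2 + b * c := by linear_combination -g20
  have hbf : b * f = -a * e + d^2 := by linear_combination -g21
  have hef : e * f = a * c := by linear_combination g00 - hbd
  have hacc : a * c^2 = 0 := by linear_combination -c * hef + e * hcf
  have hace : a * c * e = 0 := by linear_combination -e * hef + f * hee
  have heff : e * f^2 = 0 := by linear_combination f * hef + a * hcf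
  have habe : a * b * e = -a^2 * d := by linear_combination -a * hcc + hacc
  have hccd : c^2 * d = a * d^2 := by linear_combination d * hcc + e * hbd
  have hcce : c^2 * e = a * d * e := by linear_combination e * hcc + b * hee
  have hbef : b * e * f = -a * d * f := by linear_combination -f * hcc + c * hcf
  have habc : a * b * c = -a * d * f := by linear_combination -b * hef + hbef
  have hbbc : b^2 * c = c * d * e := by linear_combination c * hbb + a * hcf
  have hdde : d^2 * e = -a * d * f := by linear_combination -d * hbb + b * hbd
  have haff : a * f^2 = -a^3 - a * d * f := by linear_combination a * hff + habc
  have hbff : b * f^2 = -a^2 * b + c * d * e := by linear_combination b * hff + hbbc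
  have hbcc : b * c^2 = a^2 * c := by linear_combination -c * hff + f * hcf
  have hdff : d * f^2 = -a^2 * d := by linear_combination d * hff + c * hbd
  have hbce : b * c * e = a^2 * e := by linear_combination -e * hff + heff
  have hddd : d^3 = a * d * e := by linear_combination -d * hbf + f * hbd
  have hbbe : b^2 * e = a^2 * c := by linear_combination -b * hcc - a * hbd + hbcc
  have hbbb : b^3 = -a^2 * e + a * d^2 := by linear_combination b * hbb + a * hbf + e * hbd
  have hbbf : b^2 * f = a^2 * d := by linear_combination b * hbf - habe + d * hbd
  have hdef : d * e * f = a^3 + a * d * f + a^2 * d := by linear_combination -f * hbb - haff + hbbf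
  have hacd : a * c * d = a^3 + a * d * f + a^2 * d := by linear_combination -d * hef + hdef
  have hcdd : c * d^2 = 0 := by linear_combination -c * hbf + hace + b * hcf
  have hddf : d^2 * f = -a^2 * b + c * d * e + a^2 * c := by
    linear_combination -f * hbf + a * hef + hbff
  have haaac : a^3 * c = 0 := by linear_combination -a * hbcc + b * hacc
  have haacd : a^2 * c * d = 0 := by linear_combination -d * hbcc + c^2 * hbd
  have haadd : a^2 * d^2 = 0 := by linear_combination -a * hccd + d * hacc
  have haddd : a * d^3 = 0 := by linear_combination -d * hccd + c * hcdd
  have haddf : a * d^2 * f = 0 := by linear_combination -f * hccd + c * d * hcf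
  have haade : a^2 * d * e = 0 := by linear_combination -a * hcce + e * hacc
  have hadef : a * d * e * f = 0 := by linear_combination -f * hcce + c * e * hcf
  have haaef : a^2 * e * f = 0 := by linear_combination a^2 * hef + haaac
  have hadff : a * d * f^2 = 0 := by linear_combination f * hbef - b * heff
  have haaad : a^3 * d = 0 := by linear_combination a * hdff - hadff
  have habbf : a * b^2 * f = 0 := by linear_combination a * hbbf + haaad
  have haabe : a^2 * b * e = 0 := by linear_combination a * habe - haaad
  have haaae : a^3 * e = 0 := by linear_combination -a * hbce + b * hace
  have haaff : a^2 * f^2 = 0 := by linear_combination -a * f * hbb + habbf - hadef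
  have haadf : a^2 * d * f = -a^4 := by linear_combination a * haff - haaff
  have hadde : a * d^2 * e = a^4 := by linear_combination a * hdde - haadf
  have hccde : c^2 * d * e = a^4 := by linear_combination e * hccd + hadde
  have hbbcc : b^2 * c^2 = a^4 := by linear_combination c * hbbc + hccde
  have haabc : a^2 * b * c = a^4 := by linear_combination -b * hbcc + hbbcc
  have hbbff : b^2 * f^2 = -a^4 := by linear_combination f * hbbf + haadf
  have habbb : a * b^3 = 0 := by linear_combination a * hbbb - haaae + haadd
  have haabf : a^2 * b * f = 0 := by linear_combination -a * b * hbb + habbb - a * e * hbd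
  have haabb : a^2 * b^2 = a^4 := by linear_combination b * hbff - hbbff + c * e * hbd
  have haaaf : a^3 * f = a^4 := by linear_combination -a^2 * hbb + haabb - haade
  have habff : a * b * f^2 = 0 := by linear_combination a * f * hbf - haaef + haddf
  have haaab : a^3 * b = 0 := by linear_combination b * haff - habff - a * f * hbd
  have haaaaa : a^5 = 0 := by linear_combination -a * hbbcc + b^2 * hacc
  have haaaaf : a^4 * f = 0 := by linear_combination -f * hbbcc + b^2 * c * hcf
  simp only [quotientRules, List.forall_mem_cons, wordTerm, List.map_cons, List.map_nil, List.prod_cons,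
    List.prod_nil, List.sum_cons, List.sum_nil, zsmul_eq_mul]
  simp
  exact ⟨by linear_combination hee, by linear_combination hbd, by linear_combination hcf,
    by linear_combination hcc, by linear_combination hbb, by linear_combination hff,
    by linear_combination hbf, by linear_combination hef, by linear_combination hacc,
    by linear_combination hace, by linear_combination habe, by linear_combination hccd,
    by linear_combination hcce, by linear_combination hbef, by linear_combination habc,
    by linear_combination hbbc, by linear_combination hdde, by linear_combination haff,
    by linear_combination hbcc, by linear_combination hdff, by linear_combination hbce,
    by linear_combination hddd, by linear_combination hbbe, by linear_combination hdef,
    by linear_combination hacd, by linear_combination hcdd, by linear_combination hddf,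
    by linear_combination haaac, by linear_combination haacd, by linear_combination haadd,
    by linear_combination haddd, by linear_combination haddf, by linear_combination haade,
    by linear_combination hadef, by linear_combination haaef, by linear_combination hadff,
    by linear_combination haaad, by linear_combination haabe, by linear_combination haaae,
    by linear_combination haaff, by linear_combination haadf, by linear_combination hadde,
    by linear_combination hccde, by linear_combination haabc, by linear_combination haabf,
    by linear_combination haabb, by linear_combination haaaf, by linear_combination haaab,
    by linear_combination haaaaa, by linear_combination haaaaf⟩

/-- The words in `a, …, f`, times a diagonal commutator entry, spanning the commutator ideal
modulo the linear forms and the off-diagonal entries. -/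
def syzygyBasis : List (List (Fin 6) × Fin 2) :=
  [([], 0), ([], 1), ([0], 1), ([1], 0), ([2], 0), ([2], 1), ([3], 0), ([3], 1), ([4], 0),
  ([4], 1), ([5], 0), ([5], 1), ([0, 0], 1), ([0, 2], 1), ([0, 3], 1), ([0, 4], 1), ([0, 5], 1),
  ([1, 2], 0), ([1, 3], 0), ([2, 2], 0), ([2, 3], 0), ([2, 4], 0), ([2, 4], 1), ([3, 3], 0),
  ([3, 4], 0), ([3, 5], 0), ([0, 0, 0], 1), ([0, 0, 3], 1), ([0, 0, 4], 1), ([0, 0, 5], 1),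
  ([0, 2, 4], 1), ([2, 3, 4], 0), ([0, 0, 0, 5], 1)]

/-- Rewriting rules for the commutator ideal modulo the linear forms and the off-diagonal entries. -/
def syzygyRules : List ((List (Fin 6) × Fin 2) × List (ℤ × List (Fin 6) × Fin 2)) :=
  [(([1], 1), []), (([0], 0), []), (([4, 4], 0), []), (([4, 4], 1), []), (([2, 5], 0), []),
  (([2, 5], 1), []), (([1, 4], 0), [(1, [2, 2], 0)]), (([2, 2], 1), [(1, [0, 3], 1)]),
  (([1, 1], 0), [(1, [3, 4], 0)]), (([3, 4], 1), [(-1, [0, 5], 1)]),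
  (([5, 5], 0), [(1, [1, 2], 0)]), (([5, 5], 1), [(-1, [0, 0], 1)]),
  (([1, 5], 0), [(1, [3, 3], 0)]), (([3, 3], 1), [(1, [0, 4], 1)]),
  (([3, 5], 1), [(-1, [3, 5], 0), (1, [2, 4], 0)]),
  (([4, 5], 1), [(-1, [1, 3], 0), (1, [0, 2], 1)]),
  (([4, 5], 0), [(1, [1, 3], 0), (-1, [0, 2], 1)]), (([2, 3], 1), [(1, [2, 2], 0)]),
  (([2, 2, 4], 0), []), (([0, 2, 3], 1), []), (([1, 2, 2], 0), []),
  (([2, 2, 3], 0), [(1, [0, 2, 4], 1)]), (([1, 3, 4], 0), [(1, [0, 2, 4], 1)]),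
  (([2, 3, 4], 1), []), (([0, 4, 5], 1), []), (([0, 0, 2], 1), []), (([2, 3, 3], 0), []),
  (([3, 3, 4], 0), []), (([1, 1, 3], 0), []), (([3, 3, 5], 0), [(1, [2, 3, 4], 0)]),
  (([2, 2, 2], 0), [(1, [0, 0, 4], 1)]), (([1, 2, 4], 0), [(1, [0, 0, 4], 1)]),
  (([2, 2, 4], 1), [(-1, [0, 0, 5], 1)]), (([0, 3, 5], 1), []),
  (([1, 2, 3], 0), [(1, [0, 0, 3], 1)]), (([3, 5, 5], 0), [(1, [0, 0, 3], 1)]),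
  (([1, 3, 3], 0), [(-1, [0, 0, 0], 1)]), (([3, 4, 5], 0), [(-1, [0, 0, 0], 1)]),
  (([1, 3, 5], 0), [(1, [0, 0, 4], 1)]), (([3, 3, 3], 0), [(1, [0, 0, 4], 1)]),
  (([0, 0, 0, 0], 1), []), (([0, 0, 0, 3], 1), []), (([0, 0, 0, 4], 1), []),
  (([1, 2, 3, 4], 0), [(-1, [0, 0, 0, 5], 1)]), (([0, 0, 5, 5], 1), []), (([0, 0, 3, 3], 1), [])]

lemma syzygyBasis_closed : RulesClosed syzygyBasis syzygyRules := by decide +kernel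

/-- The rewriting rules for `x`, `y` follow from the trace identities, the off-diagonal entries and
the Koszul relation. -/
lemma syzygyRules_hold {Q : Type*} [CommRing Q] {a b c d e f x y : Q}
    (tA : b * y = 0)
    (tB : -a * x = 0)
    (tAA : d * f * x - c * e * x + d * f * y + b^2 * y = 0)
    (tBB : a^2 * x - b * e * x - b * e * y + c * d * y = 0)
    (tAB : -e * f * x - e * f * y = 0)
    (g01x : a * d * x + b * e * x - c^2 * x = 0)
    (g01y : a * d * y + b * e * y - c^2 * y = 0)
    (g02x : e^2 * x = 0)
    (g02y : e^2 * y = 0)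
    (g10x : -a * f * x + b^2 * x - d * e * x = 0)
    (g10y : -a * f * y + b^2 * y - d * e * y = 0)
    (g12x : c * f * x = 0)
    (g12y : c * f * y = 0)
    (g20x : -a^2 * x + b * c * x - f^2 * x = 0)
    (g20y : -a^2 * y + b * c * y - f^2 * y = 0)
    (g21x : -a * e * x + d^2 * x - b * f * x = 0)
    (g21y : -a * e * y + d^2 * y - b * f * y = 0)
    (k : -b * d * x - b * d * y - e * f * y + a * c * y = 0) :
    ∀ r ∈ syzygyRules, wordTerm ![a, b, c, d, e, f] ![x, y] r.1 =
      (r.2.map fun t => t.1 • wordTerm ![a, b, c, d, e, f] ![x, y] t.2).sum := by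
  have hby : b * y = 0 := by linear_combination tA
  have hax : a * x = 0 := by linear_combination -tB
  have heex : e^2 * x = 0 := by linear_combination g02x
  have heey : e^2 * y = 0 := by linear_combination g02y
  have hcfx : c * f * x = 0 := by linear_combination g12x
  have hcfy : c * f * y = 0 := by linear_combination g12y
  have hbex : b * e * x = c^2 * x := by linear_combination g01x - d * hax
  have hccy : c^2 * y = a * d * y := by linear_combination -g01y + e * hby
  have hbbx : b^2 * x = d * e * x := by linear_combination g10x + f * hax
  have hdey : d * e * y = -a * f * y := by linear_combination -g10y + b * hby
  have hffx : f^2 * x = b * c * x := by linear_combination -g20x - a * hax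
  have hffy : f^2 * y = -a^2 * y := by linear_combination -g20y + c * hby
  have hbfx : b * f * x = d^2 * x := by linear_combination -g21x - e * hax
  have hddy : d^2 * y = a * e * y := by linear_combination g21y + f * hby
  have hdfy : d * f * y = -d * f * x + c * e * x := by linear_combination tAA - b * hby
  have hefy : e * f * y = -b * d * x + a * c * y := by linear_combination -k - d * hby
  have hefx : e * f * x = b * d * x - a * c * y := by linear_combination -tAB - hefy
  have hcdy : c * d * y = c^2 * x := by linear_combination tBB - a * hax + hbex + e * hby
  have hccex : c^2 * e * x = 0 := by linear_combination -e * hbex + b * heex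
  have hbefx : b * e * f * x = 0 := by linear_combination f * hbex + c * hcfx
  have hacdy : a * c * d * y = 0 := by linear_combination a * hcdy + c^2 * hax
  have hbccx : b * c^2 * x = 0 := by linear_combination -b * hcdy + c * d * hby
  have hccdx : c^2 * d * x = a * c * e * y := by linear_combination -d * hcdy + c * hddy
  have hbdex : b * d * e * x = a * c * e * y := by linear_combination d * hbex + hccdx
  have hcdey : c * d * e * y = 0 := by linear_combination e * hcdy + hccex
  have haefy : a * e * f * y = 0 := by linear_combination e * hdey - d * heey
  have hdefy : d * e * f * y = a^3 * y := by linear_combination f * hdey - a * hffy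
  have hbffx : b * f^2 * x = c * d * e * x := by linear_combination b * hffx + c * hbbx
  have haacy : a^2 * c * y = 0 := by linear_combination c * hffy - f * hcfy
  have hcddx : c * d^2 * x = 0 := by linear_combination -c * hbfx + b * hcfx
  have hddex : d^2 * e * x = 0 := by linear_combination -e * hbfx + hbefx
  have hbbdx : b^2 * d * x = 0 := by linear_combination d * hbbx + hddex
  have hddfx : d^2 * f * x = c * d * e * x := by linear_combination -f * hbfx + hbffx
  have hccdy : c^2 * d * y = a^2 * e * y := by linear_combination d * hccy + a * hddy
  have hcccx : c^3 * x = a^2 * e * y := by linear_combination -c * hcdy + hccdy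
  have hbcex : b * c * e * x = a^2 * e * y := by linear_combination c * hbex + hcccx
  have hccey : c^2 * e * y = -a^2 * f * y := by linear_combination e * hccy + a * hdey
  have hadfy : a * d * f * y = 0 := by linear_combination -f * hccy + c * hcfy
  have hddey : d^2 * e * y = 0 := by linear_combination d * hdey - hadfy
  have hbcdx : b * c * d * x = a^2 * d * y := by linear_combination c * hefy - e * hcfy + a * hccy
  have hdffx : d * f^2 * x = a^2 * d * y := by linear_combination d * hffx + hbcdx
  have hbddx : b * d^2 * x = -a^3 * y := by linear_combination d * hefy - hdefy + hacdy
  have hbbfx : b^2 * f * x = -a^3 * y := by linear_combination b * hbfx + hbddx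
  have hdefx : d * e * f * x = -a^3 * y := by linear_combination -f * hbbx + hbbfx
  have hbdfx : b * d * f * x = a^2 * e * y := by linear_combination f * hefy - e * hffy + a * hcfy
  have hdddx : d^3 * x = a^2 * e * y := by linear_combination -d * hbfx + hbdfx
  have haaaay : a^4 * y = 0 := by linear_combination -a * hdefy + d * haefy
  have haaady : a^3 * d * y = 0 := by linear_combination -d * hdefy + f * hddey
  have haaaey : a^3 * e * y = 0 := by linear_combination -e * hdefy + d * f * heey
  have hbcdex : b * c * d * e * x = -a^3 * f * y := by linear_combination d * hbcex + a^2 * hdey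
  have haaffy : a^2 * f^2 * y = 0 := by linear_combination a * f * hdey - d * haefy
  have haaddy : a^2 * d^2 * y = 0 := by linear_combination -d * hbcdx + b * hcddx
  simp only [syzygyRules, List.forall_mem_cons, wordTerm, List.map_cons, List.map_nil, List.prod_cons,
    List.prod_nil, List.sum_cons, List.sum_nil, zsmul_eq_mul]
  simp
  exact ⟨by linear_combination hby, by linear_combination hax, by linear_combination heex,
    by linear_combination heey, by linear_combination hcfx, by linear_combination hcfy,
    by linear_combination hbex, by linear_combination hccy, by linear_combination hbbx,
    by linear_combination hdey, by linear_combination hffx, by linear_combination hffy,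
    by linear_combination hbfx, by linear_combination hddy, by linear_combination hdfy,
    by linear_combination hefy, by linear_combination hefx, by linear_combination hcdy,
    by linear_combination hccex, by linear_combination hacdy, by linear_combination hbccx,
    by linear_combination hccdx, by linear_combination hbdex, by linear_combination hcdey,
    by linear_combination haefy, by linear_combination haacy, by linear_combination hcddx,
    by linear_combination hddex, by linear_combination hbbdx, by linear_combination hddfx,
    by linear_combination hcccx, by linear_combination hbcex, by linear_combination hccey,
    by linear_combination hadfy, by linear_combination hbcdx, by linear_combination hdffx,
    by linear_combination hbddx, by linear_combination hdefx, by linear_combination hbdfx,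
    by linear_combination hdddx, by linear_combination haaaay, by linear_combination haaady,
    by linear_combination haaaey, by linear_combination hbcdex, by linear_combination haaffy,
    by linear_combination haaddy⟩

section Counting

/-- Writing exponents as `2 q + r` identifies the monomials in `ι ⊕ φ` with pairs of a family of
remainders and a monomial in which the variables of `φ` have weight two. -/
lemma exists_equiv_finsupp_degree {ι φ κ σ : Type*} [Fintype ι] [Fintype φ] [Fintype σ]
    (e : κ ≃ (φ → Fin 2)) (e' : ι ⊕ φ ≃ σ) {dg : κ → ℕ} (hdg : ∀ k, dg k = ∑ j, (e k j : ℕ)) :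
    ∃ η : (κ × (ι ⊕ φ →₀ ℕ)) ≃ (σ →₀ ℕ), ∀ k m, (η (k, m)).degree =
      m.sum (fun i n => n * Sum.elim (fun _ => 1) (fun _ => 2) i) + dg k := by
  classical
  let g : κ × (ι ⊕ φ →₀ ℕ) → ι ⊕ φ → ℕ := fun x =>
    Sum.elim (fun i => x.2 (Sum.inl i)) (fun j => 2 * x.2 (Sum.inr j) + e x.1 j)
  have hg : Function.Bijective g := by
    constructor
    · rintro ⟨k, m⟩ ⟨k', m'⟩ h
      have h1 : ∀ i, m (Sum.inl i) = m' (Sum.inl i) := fun i => congrFun h (Sum.inl i)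
      have h2 : ∀ j, 2 * m (Sum.inr j) + e k j = 2 * m' (Sum.inr j) + e k' j := fun j =>
        congrFun h (Sum.inr j)
      have hk : k = k' := e.injective (funext fun j => Fin.ext (by have := h2 j; omega))
      have hm : m = m' := by
        ext (i | j)
        · exact h1 i
        · have := h2 j
          omega
      rw [hk, hm]
    · intro y
      refine ⟨(e.symm fun j => ⟨y (Sum.inr j) % 2, by omega⟩, Finsupp.equivFunOnFinite.symm
        (Sum.elim (fun i => y (Sum.inl i)) fun j => y (Sum.inr j) / 2)), ?_⟩
      funext i
      rcases i with i | j
      · simp [g]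
      · simp only [g, Sum.elim_inr, Finsupp.equivFunOnFinite_symm_apply_apply,
          Equiv.apply_symm_apply]
        omega
  refine ⟨(Equiv.ofBijective g hg).trans ((Equiv.arrowCongr e' (Equiv.refl ℕ)).trans
    Finsupp.equivFunOnFinite.symm), fun k m => ?_⟩
  rw [Finsupp.degree_eq_sum, Finsupp.sum_fintype _ _ (by simp), hdg,
    ← Equiv.sum_comp e', Fintype.sum_sum_type, Fintype.sum_sum_type]
  simp only [Equiv.trans_apply, Finsupp.equivFunOnFinite_symm_apply_apply, Equiv.arrowCongr_apply,
    Function.comp_apply, Equiv.symm_apply_apply, Equiv.ofBijective_apply, Equiv.refl_apply, g,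
    Sum.elim_inl, Sum.elim_inr, Finset.sum_add_distrib, mul_one]
  simp only [mul_comm, add_assoc]

/-- Two finite families with the same multiset of values differ by a bijection of the indices. -/
lemma exists_equiv_of_map_univ_eq {α β γ : Type*} [Fintype α] [Fintype β] {f : α → γ} {g : β → γ}
    (h : Finset.univ.val.map f = Finset.univ.val.map g) : ∃ e : α ≃ β, ∀ a, f a = g (e a) := by
  classical
  have hcard : ∀ c, Fintype.card {a // f a = c} = Fintype.card {b // g b = c} := fun c => by
    have := congrArg (Multiset.count c) h
    simp only [Multiset.count_map, ← Finset.filter_val, Finset.card_val, eq_comm (a := c)] at this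
    rw [Fintype.card_subtype, Fintype.card_subtype, this]
  exact ⟨Equiv.ofFiberEquiv fun c => Fintype.equivOfCardEq (hcard c),
    fun a => (Equiv.ofFiberEquiv_map _ a).symm⟩

lemma map_length_basis_eq :
    Finset.univ.val.map (Sum.elim (fun k => (quotientBasis.get k).1.length)
      fun k => (syzygyBasis.get k).1.length + 2) =
    Finset.univ.val.map (fun r : Fin 6 → Fin 2 => ∑ j, (r j : ℕ)) := by
  decide +kernel

end Counting

section Pullback

variable {K σ ι τ : Type*} [Field K]

lemma wordTerm_isHomogeneous {z : ι → MvPolynomial σ K} (hz : ∀ j, (z j).IsHomogeneous 1)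
    {x : τ → MvPolynomial σ K} {n : ℕ} (hx : ∀ i, (x i).IsHomogeneous n) (p : List ι × τ) :
    (wordTerm z x p).IsHomogeneous (p.1.length + n) := by
  refine IsHomogeneous.mul ?_ (hx p.2)
  induction p.1 with
  | nil => simpa using isHomogeneous_one σ K
  | cons j l ih => simpa [add_comm] using (hz j).mul ih

lemma range_wordTerm_get {Q : Type*} [CommRing Q] (z : ι → Q) (x : τ → Q)
    (S : List (List ι × τ)) :
    Set.range (fun k => wordTerm z x (S.get k)) = wordTerm z x '' {q | q ∈ S} := by
  rw [← Set.range_list_get S, ← Set.range_comp]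
  rfl

/-- Rewriting rules that are valid modulo an ideal. -/
lemma mul_wordTerm_mem_span_sup [DecidableEq ι] {N : Ideal (MvPolynomial σ K)}
    {z : ι → MvPolynomial σ K} {x : τ → MvPolynomial σ K} {S : List (List ι × τ)}
    {rules : List ((List ι × τ) × List (ℤ × List ι × τ))} (hS : RulesClosed S rules)
    (hr : ∀ r ∈ rules, wordTerm (Ideal.Quotient.mk N ∘ z) (Ideal.Quotient.mk N ∘ x) r.1 =
      (r.2.map fun t => t.1 •
        wordTerm (Ideal.Quotient.mk N ∘ z) (Ideal.Quotient.mk N ∘ x) t.2).sum)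
    (j : ι) (k : Fin S.length) :
    z j * wordTerm z x (S.get k) ∈
      Submodule.span K (Set.range fun k => wordTerm z x (S.get k)) ⊔ N.restrictScalars K := by
  have hmk : ∀ p, Ideal.Quotient.mk N (wordTerm z x p) =
      wordTerm (Ideal.Quotient.mk N ∘ z) (Ideal.Quotient.mk N ∘ x) p := fun p => by
    simp [wordTerm, map_list_prod]
  have hker : LinearMap.ker (Ideal.Quotient.mkₐ K N).toLinearMap = N.restrictScalars K := by
    ext y
    simp [Ideal.Quotient.eq_zero_iff_mem]
  rw [← hker, ← Submodule.comap_map_eq, Submodule.mem_comap, Submodule.map_span,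
    range_wordTerm_get, Set.image_image]
  have := mul_wordTerm_mem_span K hS hr j (S.get_mem k)
  simpa [hmk] using this

end Pullback

section CommutingScheme

local notation "R₃" => MvPolynomial ((Fin 3 × Fin 3) ⊕ (Fin 3 × Fin 3)) ℂ

/-- The first generic matrix. -/
noncomputable def genericA : Matrix (Fin 3) (Fin 3) R₃ := Matrix.of fun i j => X (Sum.inl (i, j))

/-- The second generic matrix. -/
noncomputable def genericB : Matrix (Fin 3) (Fin 3) R₃ := Matrix.of fun i j => X (Sum.inr (i, j))

/-- The commutator of the generic matrices. -/
noncomputable def genericComm : Matrix (Fin 3) (Fin 3) R₃ :=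
  genericA * genericB - genericB * genericA

/-- The ideal of the commuting scheme. -/
noncomputable def commIdeal : Ideal R₃ :=
  Ideal.span (Set.range fun p : Fin 3 × Fin 3 => genericComm p.1 p.2)

/-- The off-diagonal entries of the commutator. -/
noncomputable def offDiag : Fin 6 → R₃ :=
  ![genericComm 0 1, genericComm 0 2, genericComm 1 0, genericComm 1 2, genericComm 2 0,
    genericComm 2 1]

/-- Linear forms that are a system of parameters on the commuting scheme. -/
noncomputable def paramForms : Fin 12 → R₃ :=
  ![genericA 0 0, genericA 0 2, genericA 2 2, genericB 0 0 + genericA 2 0,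
    genericB 0 1 + genericA 1 2, genericB 0 2 - genericA 2 1, genericB 1 0 - genericA 1 1,
    genericB 1 1, genericB 1 2, genericB 2 0 + genericA 0 1, genericB 2 1 - genericA 1 0,
    genericB 2 2]

/-- Variables that form a basis of the linear forms modulo `paramForms`. -/
noncomputable def freeVars : Fin 6 → R₃ :=
  ![genericA 2 0, genericA 1 1, genericA 2 1, genericA 0 1, genericA 1 2, genericA 1 0]

/-- The first generic matrix modulo `paramForms`. -/
noncomputable def reducedA : Matrix (Fin 3) (Fin 3) R₃ :=
  !![0, freeVars 3, 0; freeVars 5, freeVars 1, freeVars 4; freeVars 0, freeVars 2, 0]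

/-- The second generic matrix modulo `paramForms`. -/
noncomputable def reducedB : Matrix (Fin 3) (Fin 3) R₃ :=
  !![-freeVars 0, -freeVars 4, freeVars 2; freeVars 1, 0, 0; -freeVars 3, freeVars 5, 0]

/-- The substitution solving `paramForms = 0` for the variables other than `freeVars`. -/
noncomputable def reduceParams : R₃ →ₐ[ℂ] R₃ :=
  aeval (Sum.elim (fun p => reducedA p.1 p.2) fun p => reducedB p.1 p.2)

lemma reduceParams_genericA (i j : Fin 3) : reduceParams (genericA i j) = reducedA i j := by
  simp only [reduceParams, genericA, Matrix.of_apply, aeval_X, Sum.elim_inl]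

lemma reduceParams_genericB (i j : Fin 3) : reduceParams (genericB i j) = reducedB i j := by
  simp only [reduceParams, genericB, Matrix.of_apply, aeval_X, Sum.elim_inr]

lemma genericA_isHomogeneous (i j : Fin 3) : (genericA i j).IsHomogeneous 1 :=
  isHomogeneous_X _ _

lemma genericB_isHomogeneous (i j : Fin 3) : (genericB i j).IsHomogeneous 1 :=
  isHomogeneous_X _ _

lemma genericComm_isHomogeneous (i j : Fin 3) : (genericComm i j).IsHomogeneous 2 := by
  simp only [genericComm, Matrix.sub_apply, Matrix.mul_apply]
  exact (IsHomogeneous.sum _ _ _ fun k _ =>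
    (genericA_isHomogeneous i k).mul (genericB_isHomogeneous k j)).sub
    (IsHomogeneous.sum _ _ _ fun k _ =>
      (genericB_isHomogeneous i k).mul (genericA_isHomogeneous k j))

lemma offDiag_isHomogeneous (i : Fin 6) : (offDiag i).IsHomogeneous 2 := by
  fin_cases i <;> exact genericComm_isHomogeneous _ _

lemma freeVars_isHomogeneous (i : Fin 6) : (freeVars i).IsHomogeneous 1 := by
  fin_cases i <;> exact genericA_isHomogeneous _ _

lemma paramForms_isHomogeneous (i : Fin 12) : (paramForms i).IsHomogeneous 1 := by
  have hA := genericA_isHomogeneous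
  have hB := genericB_isHomogeneous
  fin_cases i
  exacts [hA _ _, hA _ _, hA _ _, (hB _ _).add (hA _ _), (hB _ _).add (hA _ _),
    (hB _ _).sub (hA _ _), (hB _ _).sub (hA _ _), hB _ _, hB _ _, (hB _ _).add (hA _ _),
    (hB _ _).sub (hA _ _), hB _ _]

lemma genericA_sub_reducedA_mem (i j : Fin 3) :
    genericA i j - reducedA i j ∈ Ideal.span (Set.range paramForms) := by
  have hθ : ∀ k, paramForms k ∈ Ideal.span (Set.range paramForms) := fun k =>
    Ideal.subset_span ⟨k, rfl⟩
  fin_cases i <;> fin_cases j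
  · convert hθ 0 using 1
    simp [paramForms, reducedA, freeVars]
  · simp [reducedA, freeVars]
  · convert hθ 1 using 1
    simp [paramForms, reducedA, freeVars]
  · simp [reducedA, freeVars]
  · simp [reducedA, freeVars]
  · simp [reducedA, freeVars]
  · simp [reducedA, freeVars]
  · simp [reducedA, freeVars]
  · convert hθ 2 using 1
    simp [paramForms, reducedA, freeVars]

lemma genericB_sub_reducedB_mem (i j : Fin 3) :
    genericB i j - reducedB i j ∈ Ideal.span (Set.range paramForms) := by
  have hθ : ∀ k, paramForms k ∈ Ideal.span (Set.range paramForms) := fun k =>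
    Ideal.subset_span ⟨k, rfl⟩
  fin_cases i <;> fin_cases j
  · convert hθ 3 using 1
    simp [paramForms, reducedB, freeVars]
  · convert hθ 4 using 1
    simp [paramForms, reducedB, freeVars]
  · convert hθ 5 using 1
    simp [paramForms, reducedB, freeVars]
  · convert hθ 6 using 1
    simp [paramForms, reducedB, freeVars]
  · convert hθ 7 using 1
    simp [paramForms, reducedB, freeVars]
  · convert hθ 8 using 1
    simp [paramForms, reducedB, freeVars]
  · convert hθ 9 using 1
    simp [paramForms, reducedB, freeVars]
  · convert hθ 10 using 1
    simp [paramForms, reducedB, freeVars]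
  · convert hθ 11 using 1
    simp [paramForms, reducedB, freeVars]

lemma X_sub_reduceParams_mem (s : (Fin 3 × Fin 3) ⊕ (Fin 3 × Fin 3)) :
    X s - reduceParams (X s) ∈ Ideal.span (Set.range paramForms) := by
  rcases s with ⟨i, j⟩ | ⟨i, j⟩
  · exact reduceParams_genericA i j ▸ genericA_sub_reducedA_mem i j
  · exact reduceParams_genericB i j ▸ genericB_sub_reducedB_mem i j

lemma sub_reduceParams_mem (x : R₃) :
    x - reduceParams x ∈ Ideal.span (Set.range paramForms) := by
  induction x using MvPolynomial.induction_on with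
  | C a => simp [reduceParams]
  | add p q hp hq =>
    rw [map_add, add_sub_add_comm]
    exact Ideal.add_mem _ hp hq
  | mul_X p s hp =>
    rw [map_mul, show p * X s - reduceParams p * reduceParams (X s) =
      X s * (p - reduceParams p) + reduceParams p * (X s - reduceParams (X s)) by ring]
    exact Ideal.add_mem _ (Ideal.mul_mem_left _ _ hp)
      (Ideal.mul_mem_left _ _ (X_sub_reduceParams_mem s))

lemma reduceParams_X_mem (s : (Fin 3 × Fin 3) ⊕ (Fin 3 × Fin 3)) :
    reduceParams (X s) ∈ Submodule.span ℂ (Set.range freeVars) := by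
  have hz : ∀ k, freeVars k ∈ Submodule.span ℂ (Set.range freeVars) := fun k =>
    Submodule.subset_span ⟨k, rfl⟩
  have hA : ∀ i j, reducedA i j ∈ Submodule.span ℂ (Set.range freeVars) := by
    intro i j
    fin_cases i <;> fin_cases j <;> simp [reducedA, hz]
  have hB : ∀ i j, reducedB i j ∈ Submodule.span ℂ (Set.range freeVars) := by
    intro i j
    fin_cases i <;> fin_cases j <;> simp [reducedB, hz]
  rcases s with ⟨i, j⟩ | ⟨i, j⟩
  · exact reduceParams_genericA i j ▸ hA i j
  · exact reduceParams_genericB i j ▸ hB i j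

lemma X_mem_span_freeVars_sup (s : (Fin 3 × Fin 3) ⊕ (Fin 3 × Fin 3)) :
    (X s : R₃) ∈ Submodule.span ℂ (Set.range freeVars) ⊔
      (Ideal.span (Set.range paramForms)).restrictScalars ℂ := by
  rw [← add_sub_cancel (reduceParams (X s)) (X s)]
  exact Submodule.add_mem_sup (reduceParams_X_mem s) (X_sub_reduceParams_mem s)

lemma genericComm_mem_commIdeal (i j : Fin 3) : genericComm i j ∈ commIdeal :=
  Ideal.subset_span ⟨(i, j), rfl⟩

lemma genericComm_mem_offDiag {i j : Fin 3} (h : i ≠ j) :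
    genericComm i j ∈ Ideal.span (Set.range offDiag) := by
  have hf : ∀ k, offDiag k ∈ Ideal.span (Set.range offDiag) := fun k =>
    Ideal.subset_span ⟨k, rfl⟩
  fin_cases i <;> fin_cases j <;> first | exact absurd rfl h | skip
  exacts [hf 0, hf 1, hf 2, hf 3, hf 4, hf 5]

lemma span_offDiag_le : Ideal.span (Set.range offDiag) ≤ commIdeal := by
  rw [Ideal.span_le]
  rintro _ ⟨k, rfl⟩
  fin_cases k <;> exact genericComm_mem_commIdeal _ _

lemma genericComm_two_two : genericComm 2 2 = -genericComm 0 0 - genericComm 1 1 := by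
  have h : genericComm.trace = 0 := by
    rw [genericComm, Matrix.trace_sub, Matrix.trace_mul_comm, sub_self]
  rw [Matrix.trace_fin_three] at h
  linear_combination h

/-- A matrix trace-orthogonal to the commutator gives a relation between its diagonal entries
modulo the off-diagonal ones. -/
lemma diag_relation_mem {P : Matrix (Fin 3) (Fin 3) R₃} (h : (P * genericComm).trace = 0) :
    (P 0 0 - P 2 2) * genericComm 0 0 + (P 1 1 - P 2 2) * genericComm 1 1 ∈
      Ideal.span (Set.range offDiag) := by
  simp only [Matrix.trace_fin_three, Matrix.mul_apply, Fin.sum_univ_three,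
    genericComm_two_two] at h
  have hmem : ∀ i j : Fin 3, i ≠ j → ∀ p, p * genericComm i j ∈ Ideal.span (Set.range offDiag) :=
    fun i j hij p => Ideal.mul_mem_left _ _ (genericComm_mem_offDiag hij)
  have := neg_mem (add_mem (add_mem (add_mem (hmem 1 0 (by decide) (P 0 1))
    (hmem 2 0 (by decide) (P 0 2))) (add_mem (hmem 0 1 (by decide) (P 1 0))
    (hmem 2 1 (by decide) (P 1 2)))) (add_mem (hmem 0 2 (by decide) (P 2 0))
    (hmem 1 2 (by decide) (P 2 1))))
  convert this using 1
  linear_combination h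

lemma trace_mul_genericComm_of_commute_A {P : Matrix (Fin 3) (Fin 3) R₃}
    (h : Commute P genericA) : (P * genericComm).trace = 0 := by
  rw [genericComm, mul_sub, Matrix.trace_sub, sub_eq_zero, ← mul_assoc, h.eq,
    mul_assoc, Matrix.trace_mul_comm, mul_assoc]

lemma trace_mul_genericComm_of_commute_B {P : Matrix (Fin 3) (Fin 3) R₃}
    (h : Commute P genericB) : (P * genericComm).trace = 0 := by
  rw [genericComm, mul_sub, Matrix.trace_sub, sub_eq_zero, ← mul_assoc P genericB, h.eq,
    mul_assoc, Matrix.trace_mul_comm genericB, mul_assoc]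

lemma trace_anticomm_mul_genericComm :
    ((genericA * genericB + genericB * genericA) * genericComm).trace = 0 := by
  have h : (genericA * genericB + genericB * genericA) * genericComm =
      genericA * genericB * (genericA * genericB) - genericB * genericA * (genericB * genericA) +
        (genericB * genericA * (genericA * genericB) -
          genericA * genericB * (genericB * genericA)) := by
    rw [genericComm]
    noncomm_ring
  rw [h, Matrix.trace_add, Matrix.trace_sub, Matrix.trace_sub,
    Matrix.trace_mul_comm (genericB * genericA) (genericA * genericB), sub_self, add_zero,
    mul_assoc, Matrix.trace_mul_comm, mul_assoc, ← mul_assoc, sub_eq_zero]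
  simp only [mul_assoc]

lemma diag_relation_mul_mem :
    ((genericA * genericB) 0 0 - (genericA * genericB) 2 2 - genericComm 0 0) * genericComm 0 0 +
      ((genericA * genericB) 1 1 - (genericA * genericB) 2 2 - genericComm 0 0 - genericComm 1 1) *
        genericComm 1 1 ∈ Ideal.span (Set.range offDiag) := by
  have h := Ideal.mul_mem_left _ (C (2⁻¹ : ℂ)) (diag_relation_mem trace_anticomm_mul_genericComm)
  have hBA : ∀ i, (genericA * genericB + genericB * genericA) i i =
      2 * (genericA * genericB) i i - genericComm i i := fun i => by
    rw [genericComm, Matrix.add_apply, Matrix.sub_apply]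
    ring
  have h2 : (C (2⁻¹ : ℂ) : R₃) * 2 = 1 := by
    rw [← map_ofNat (C : ℂ →+* R₃) 2, ← map_mul]
    norm_num
  rw [hBA, hBA, hBA, genericComm_two_two] at h
  convert h using 1
  linear_combination -(((genericA * genericB) 0 0 - (genericA * genericB) 2 2 - genericComm 0 0) *
    genericComm 0 0 + ((genericA * genericB) 1 1 - (genericA * genericB) 2 2 - genericComm 0 0 -
      genericComm 1 1) * genericComm 1 1) * h2

/-- Modulo `paramForms` times the ideal, coefficients may be reduced. -/
lemma mk_reduceParams_mul {N : Ideal R₃} (hN : Ideal.span (Set.range paramForms) * commIdeal ≤ N)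
    {m : R₃} (hm : m ∈ commIdeal) (q : R₃) :
    Ideal.Quotient.mk N (reduceParams q) * Ideal.Quotient.mk N m =
      Ideal.Quotient.mk N (q * m) := by
  rw [← map_mul, eq_comm, Ideal.Quotient.mk_eq_mk_iff_sub_mem, ← sub_mul]
  exact hN (Ideal.mul_mem_mul (sub_reduceParams_mem q) hm)

lemma mk_reduceParams_diag {N : Ideal R₃}
    (hN : Ideal.span (Set.range paramForms) * commIdeal ≤ N)
    (hN' : Ideal.span (Set.range offDiag) ≤ N) {p q : R₃}
    (h : p * genericComm 0 0 + q * genericComm 1 1 ∈ Ideal.span (Set.range offDiag)) :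
    Ideal.Quotient.mk N (reduceParams p) * Ideal.Quotient.mk N (genericComm 0 0) +
      Ideal.Quotient.mk N (reduceParams q) * Ideal.Quotient.mk N (genericComm 1 1) = 0 := by
  rw [mk_reduceParams_mul hN (genericComm_mem_commIdeal 0 0),
    mk_reduceParams_mul hN (genericComm_mem_commIdeal 1 1), ← map_add,
    Ideal.Quotient.eq_zero_iff_mem]
  exact hN' h

lemma reduceParams_genericComm (i j : Fin 3) :
    reduceParams (genericComm i j) = (reducedA * reducedB - reducedB * reducedA) i j := by
  simp [genericComm, Matrix.mul_apply, reduceParams_genericA, reduceParams_genericB]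

lemma syzygyRules_hold_mk {N : Ideal R₃}
    (hN : Ideal.span (Set.range paramForms) * commIdeal ≤ N)
    (hN' : Ideal.span (Set.range offDiag) ≤ N) :
    ∀ r ∈ syzygyRules, wordTerm (Ideal.Quotient.mk N ∘ freeVars)
        (Ideal.Quotient.mk N ∘ ![genericComm 0 0, genericComm 1 1]) r.1 =
      (r.2.map fun t => t.1 • wordTerm (Ideal.Quotient.mk N ∘ freeVars)
        (Ideal.Quotient.mk N ∘ ![genericComm 0 0, genericComm 1 1]) t.2).sum := by
  have hz : Ideal.Quotient.mk N ∘ freeVars = ![Ideal.Quotient.mk N (freeVars 0),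
      Ideal.Quotient.mk N (freeVars 1), Ideal.Quotient.mk N (freeVars 2),
      Ideal.Quotient.mk N (freeVars 3), Ideal.Quotient.mk N (freeVars 4),
      Ideal.Quotient.mk N (freeVars 5)] := by
    ext j
    fin_cases j <;> rfl
  have hx : Ideal.Quotient.mk N ∘ ![genericComm 0 0, genericComm 1 1] =
      ![Ideal.Quotient.mk N (genericComm 0 0), Ideal.Quotient.mk N (genericComm 1 1)] := by
    ext j
    fin_cases j <;> rfl
  have hd {p q : R₃} := mk_reduceParams_diag hN hN' (p := p) (q := q)
  have hg (i j : Fin 3) (hij : i ≠ j) (l : Fin 3) := (mk_reduceParams_mul hN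
    (genericComm_mem_commIdeal l l) (genericComm i j)).trans
      (Ideal.Quotient.eq_zero_iff_mem.2
        (hN' (Ideal.mul_mem_right (genericComm l l) _ (genericComm_mem_offDiag hij))))
  have tA := hd (diag_relation_mem (trace_mul_genericComm_of_commute_A (Commute.refl _)))
  have tB := hd (diag_relation_mem (trace_mul_genericComm_of_commute_B (Commute.refl _)))
  have tAA := hd (diag_relation_mem (trace_mul_genericComm_of_commute_A
    ((Commute.refl genericA).mul_left (Commute.refl genericA))))
  have tBB := hd (diag_relation_mem (trace_mul_genericComm_of_commute_B
    ((Commute.refl genericB).mul_left (Commute.refl genericB))))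
  have tAB := hd diag_relation_mul_mem
  have k := hd (p := genericComm 1 1) (q := -genericComm 0 0) (by
    rw [show genericComm 1 1 * genericComm 0 0 + -genericComm 0 0 * genericComm 1 1 = 0 by ring]
    exact zero_mem _)
  simp only [map_add, map_sub, map_neg, map_mul, reduceParams_genericA, reduceParams_genericB,
    reduceParams_genericComm, Matrix.sub_apply, Matrix.mul_apply, Fin.sum_univ_three]
    at tA tB tAA tBB tAB k hg
  have g01x := hg 0 1 (by decide) 0
  have g01y := hg 0 1 (by decide) 1
  have g02x := hg 0 2 (by decide) 0
  have g02y := hg 0 2 (by decide) 1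
  have g10x := hg 1 0 (by decide) 0
  have g10y := hg 1 0 (by decide) 1
  have g12x := hg 1 2 (by decide) 0
  have g12y := hg 1 2 (by decide) 1
  have g20x := hg 2 0 (by decide) 0
  have g20y := hg 2 0 (by decide) 1
  have g21x := hg 2 1 (by decide) 0
  have g21y := hg 2 1 (by decide) 1
  simp [reducedA, reducedB]
    at tA tB tAA tBB tAB k g01x g01y g02x g02y g10x g10y g12x g12y g20x g20y g21x g21y
  rw [hz, hx]
  apply syzygyRules_hold
  · linear_combination tA
  · linear_combination tB
  · linear_combination tAA
  · linear_combination tBB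
  · linear_combination tAB
  · linear_combination g01x
  · linear_combination g01y
  · linear_combination g02x
  · linear_combination g02y
  · linear_combination g10x
  · linear_combination g10y
  · linear_combination g12x
  · linear_combination g12y
  · linear_combination g20x
  · linear_combination g20y
  · linear_combination g21x
  · linear_combination g21y
  · linear_combination k

lemma quotientRules_hold_mk {N : Ideal R₃}
    (hN : Ideal.span (Set.range paramForms) ≤ N) (hN' : commIdeal ≤ N) :
    ∀ r ∈ quotientRules, wordTerm (Ideal.Quotient.mk N ∘ freeVars)
        (Ideal.Quotient.mk N ∘ ![1]) r.1 =
      (r.2.map fun t => t.1 • wordTerm (Ideal.Quotient.mk N ∘ freeVars)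
        (Ideal.Quotient.mk N ∘ ![1]) t.2).sum := by
  have hz : Ideal.Quotient.mk N ∘ freeVars = ![Ideal.Quotient.mk N (freeVars 0),
      Ideal.Quotient.mk N (freeVars 1), Ideal.Quotient.mk N (freeVars 2),
      Ideal.Quotient.mk N (freeVars 3), Ideal.Quotient.mk N (freeVars 4),
      Ideal.Quotient.mk N (freeVars 5)] := by
    ext j
    fin_cases j <;> rfl
  have hx : Ideal.Quotient.mk N ∘ ![1] = ![1] := by
    ext j
    fin_cases j
    exact map_one _
  have hg (i j : Fin 3) : Ideal.Quotient.mk N (reduceParams (genericComm i j)) = 0 := by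
    rw [Ideal.Quotient.eq_zero_iff_mem,
      ← sub_sub_cancel (genericComm i j) (reduceParams (genericComm i j))]
    exact sub_mem (hN' (genericComm_mem_commIdeal i j)) (hN (sub_reduceParams_mem _))
  simp only [reduceParams_genericComm, Matrix.sub_apply, Matrix.mul_apply,
    Fin.sum_univ_three] at hg
  have g00 := hg 0 0
  have g01 := hg 0 1
  have g02 := hg 0 2
  have g10 := hg 1 0
  have g11 := hg 1 1
  have g12 := hg 1 2
  have g20 := hg 2 0
  have g21 := hg 2 1
  simp [reducedA, reducedB] at g00 g01 g02 g10 g11 g12 g20 g21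
  rw [hz, hx]
  apply quotientRules_hold
  · linear_combination g00
  · linear_combination g01
  · linear_combination g02
  · linear_combination g10
  · linear_combination g11
  · linear_combination g12
  · linear_combination g20
  · linear_combination g21

/-- The basis of the coordinate ring modulo `paramForms`. -/
noncomputable def quotientElem (k : Fin quotientBasis.length) : R₃ :=
  wordTerm freeVars ![1] (quotientBasis.get k)

/-- The basis of the ideal modulo `paramForms` and the off-diagonal entries. -/
noncomputable def idealElem (k : Fin syzygyBasis.length) : R₃ :=
  wordTerm freeVars ![genericComm 0 0, genericComm 1 1] (syzygyBasis.get k)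

lemma quotientElem_isHomogeneous (k : Fin quotientBasis.length) :
    (quotientElem k).IsHomogeneous (quotientBasis.get k).1.length :=
  wordTerm_isHomogeneous freeVars_isHomogeneous (n := 0)
    (fun i => by fin_cases i; exact isHomogeneous_one _ _) _

lemma idealElem_isHomogeneous (k : Fin syzygyBasis.length) :
    (idealElem k).IsHomogeneous ((syzygyBasis.get k).1.length + 2) :=
  wordTerm_isHomogeneous freeVars_isHomogeneous
    (fun i => by fin_cases i <;> exact genericComm_isHomogeneous _ _) _

lemma top_le_span_quotientElem_sup :
    ⊤ ≤ Submodule.span ℂ (Set.range quotientElem) ⊔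
      (Ideal.span (Set.range paramForms) ⊔ commIdeal).restrictScalars ℂ := by
  have h := le_span_sup_of_mul_mem X_mem_span_freeVars_sup (E := quotientElem) (G := {1})
    (L := commIdeal)
  simp only [Ideal.span_singleton_one, Ideal.mul_top] at h
  refine h le_top (fun _ => trivial) ?_
    (mul_wordTerm_mem_span_sup quotientBasis_closed
      (quotientRules_hold_mk le_sup_left le_sup_right))
  rintro _ rfl
  exact Submodule.mem_sup_left (Submodule.subset_span ⟨⟨0, by decide⟩, mul_one _⟩)

lemma commIdeal_le_span_idealElem_sup :
    commIdeal.restrictScalars ℂ ≤ Submodule.span ℂ (Set.range idealElem) ⊔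
      (Ideal.span (Set.range paramForms) * commIdeal ⊔
        Ideal.span (Set.range offDiag)).restrictScalars ℂ := by
  have hmem : ∀ i : Fin 2, ![genericComm 0 0, genericComm 1 1] i ∈
      Submodule.span ℂ (Set.range idealElem) := by
    intro i
    obtain ⟨k, hk⟩ := List.get_of_mem
      (show (([], i) : List (Fin 6) × Fin 2) ∈ syzygyBasis by revert i; decide)
    refine Submodule.subset_span ⟨k, ?_⟩
    rw [idealElem, hk]
    exact one_mul _
  refine le_span_sup_of_mul_mem X_mem_span_freeVars_sup span_offDiag_le ?_ ?_
    (mul_wordTerm_mem_span_sup syzygyBasis_closed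
      (syzygyRules_hold_mk le_sup_left le_sup_right))
  · intro k
    refine Ideal.mul_mem_left _ _ ?_
    generalize (syzygyBasis.get k).2 = i
    fin_cases i <;> exact genericComm_mem_commIdeal _ _
  · rintro _ ⟨⟨i, j⟩, rfl⟩
    by_cases hij : i = j
    · subst hij
      refine Submodule.mem_sup_left ?_
      fin_cases i
      · exact hmem 0
      · exact hmem 1
      · change genericComm 2 2 ∈ _
        rw [genericComm_two_two]
        exact sub_mem (neg_mem (hmem 0)) (hmem 1)
    · exact Submodule.mem_sup_right (Ideal.mem_sup_right (genericComm_mem_offDiag hij))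

lemma commIdeal_isHomogeneous :
    letI := MvPolynomial.gradedAlgebra (σ := (Fin 3 × Fin 3) ⊕ (Fin 3 × Fin 3)) (R := ℂ)
    commIdeal.IsHomogeneous (homogeneousSubmodule _ ℂ) := by
  let := MvPolynomial.gradedAlgebra (σ := (Fin 3 × Fin 3) ⊕ (Fin 3 × Fin 3)) (R := ℂ)
  refine Ideal.homogeneous_span _ _ ?_
  rintro _ ⟨p, rfl⟩
  exact ⟨2, genericComm_isHomogeneous p.1 p.2⟩

lemma gradedPieceDim_commIdeal {t : ℕ} (ht : 4 ≤ t) :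
    gradedPieceDim commIdeal t =
      ∑ k, (t - (quotientBasis.get k).1.length + 11).choose 11 := by
  obtain ⟨e, he⟩ := exists_equiv_of_map_univ_eq map_length_basis_eq
  obtain ⟨η, hη⟩ := exists_equiv_finsupp_degree e
    (Fintype.equivOfCardEq (α := Fin 12 ⊕ Fin 6) (β := (Fin 3 × Fin 3) ⊕ (Fin 3 × Fin 3))
      (by simp)) he
  have hlen : ∀ k, (quotientBasis.get k).1.length ≤ t := fun k =>
    le_trans ((by decide : ∀ k, (quotientBasis.get k).1.length ≤ 4) k) ht
  exact finrank_map_homogeneousSubmodule paramForms_isHomogeneous quotientElem_isHomogeneous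
    commIdeal_isHomogeneous
    (mk_comp_aevalCombination_bijective paramForms_isHomogeneous offDiag_isHomogeneous
      quotientElem_isHomogeneous idealElem_isHomogeneous commIdeal_isHomogeneous
      top_le_span_quotientElem_sup commIdeal_le_span_idealElem_sup η hη) hlen

lemma commIdeal_eq : commIdeal = Ideal.span (Set.range fun p : Fin 3 × Fin 3 =>
    ∑ k : Fin 3, ((X (Sum.inl (p.1, k)) * X (Sum.inr (k, p.2)) -
      X (Sum.inr (p.1, k)) * X (Sum.inl (k, p.2))) : R₃)) := by
  simp [commIdeal, genericComm, genericA, genericB, Matrix.mul_apply, Finset.sum_sub_distrib]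

lemma varietyHasDegree_of_gradedPieceDim {σ κ : Type*} [Fintype κ] [Nonempty κ]
    {I : Ideal (MvPolynomial σ ℂ)} {m n₀ : ℕ} {dg : κ → ℕ} (hdg : ∀ k, dg k ≤ n₀)
    (h : ∀ t, n₀ ≤ t → gradedPieceDim I t = ∑ k, (t - dg k + m).choose m) :
    VarietyHasDegree I (Fintype.card κ) := by
  set P : Polynomial ℚ := ∑ k, Polynomial.preHilbertPoly ℚ m (dg k) with hP
  have hcoeff : P.coeff m = Fintype.card κ * (m.factorial : ℚ)⁻¹ := by
    simp [hP, Polynomial.finsetSum_coeff, Polynomial.coeff_preHilbertPoly_self]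
  have hdeg : P.natDegree = m := by
    refine le_antisymm (Polynomial.natDegree_sum_le_of_forall_le _ _ fun k _ =>
      (Polynomial.natDegree_preHilbertPoly ℚ m (dg k)).le) (Polynomial.le_natDegree_of_ne_zero ?_)
    rw [hcoeff]
    have := Fintype.card_pos (α := κ)
    positivity
  refine ⟨P, ⟨n₀, fun t ht => ?_⟩, ?_⟩
  · rw [h t ht, hP, Polynomial.eval_finsetSum, Nat.cast_sum]
    exact Finset.sum_congr rfl fun k _ =>
      Polynomial.preHilbertPoly_eq_choose_sub_add ℚ m ((hdg k).trans ht)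
  · rw [Polynomial.leadingCoeff, hdeg, hcoeff]
    field_simp

end CommutingScheme

/-- The commuting scheme for `3×3` matrices, cut out by the entries of
`AB - BA` for generic `3×3` matrices `A` (variables `Sum.inl (i,j)`) and `B` (variables
`Sum.inr (i,j)`), has degree `31`. -/
theorem degree_commuting_scheme_three :
    VarietyHasDegree
      (Ideal.span (Set.range fun p : Fin 3 × Fin 3 =>
        ∑ k : Fin 3,
          ((MvPolynomial.X (Sum.inl (p.1, k)) * MvPolynomial.X (Sum.inr (k, p.2)) -
            MvPolynomial.X (Sum.inr (p.1, k)) * MvPolynomial.X (Sum.inl (k, p.2))) :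
            MvPolynomial ((Fin 3 × Fin 3) ⊕ (Fin 3 × Fin 3)) ℂ)))
      31 := by
  rw [← commIdeal_eq]
  have : Nonempty (Fin quotientBasis.length) := ⟨⟨0, by decide⟩⟩
  have h := varietyHasDegree_of_gradedPieceDim (by decide) fun t =>
    gradedPieceDim_commIdeal (t := t)
  rwa [Fintype.card_fin] at h
end

section
/- Let R = C[x_{11}, x_{12}, x_{13}, x_{14}, x_{15}, x_{21}, x_{22}, x_{23}, x_{24}, x_{31}, x_{32}, x_{33}, x_{41}, x_{42}, x_{51}] and let I = ⟨x_{21}, x_{11}, x_{13}x_{22} - x_{23}x_{12}, x_{14}x_{31} + x_{13}x_{41} + x_{12}x_{51}⟩. Then the degree of the projective variety V(I) equals 4. (This computes the Hilbert-Samuel multiplicity of the Schubert variety X_{463512} at the identity coset: mult_{p_id}(X_{463512}) = 4.) -/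
open MvPolynomial

/-- Index type for the 15 variables `x_{ij}` with `1 ≤ i ≤ 5`, `1 ≤ j ≤ 6 - i`
(here 0-indexed, so the variable `x_{ij}` of the paper corresponds to `(i-1, j-1)`). -/
abbrev KLVar : Type := {p : Fin 5 × Fin 5 // (p.1 : ℕ) + (p.2 : ℕ) ≤ 4}

/-- The variable `x_{(i+1)(j+1)}` of the paper. -/
noncomputable def xv (i j : Fin 5) (h : (i : ℕ) + (j : ℕ) ≤ 4) : MvPolynomial KLVar ℂ :=
  MvPolynomial.X ⟨(i, j), h⟩

namespace MvPolynomial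

attribute [local instance] MvPolynomial.gradedAlgebra

variable {σ : Type*}

theorem homogeneousComponent_add_mul_of_isHomogeneous {R : Type*} [CommRing R] {d : ℕ}
    {f : MvPolynomial σ R} (hf : f.IsHomogeneous d) (q : MvPolynomial σ R) (t : ℕ) :
    homogeneousComponent (d + t) (f * q) = f * homogeneousComponent t q := by
  rw [← decomposition.decompose'_apply, ← decomposition.decompose'_apply]
  exact DirectSum.coe_decompose_mul_add_of_left_mem (homogeneousSubmodule σ R) hf

theorem finrank_homogeneousSubmodule {K : Type*} [Field K] [Fintype σ] (t : ℕ) :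
    Module.finrank K (homogeneousSubmodule σ K t) = (Fintype.card σ).multichoose t := by
  classical
  rw [homogeneousSubmodule_eq_finsupp_supported]
  refine (Module.finrank_eq_nat_card_basis
    (basisRestrictSupport K {d : σ →₀ ℕ | d.degree = t})).trans ?_
  rw [← Finset.card_univ, ← Finset.card_finsuppAntidiag_nat_eq_multichoose]
  have : {d : σ →₀ ℕ | d.degree = t} = (Finset.univ.finsuppAntidiag t : Finset (σ →₀ ℕ)) := by
    ext d
    simp [Finset.mem_finsuppAntidiag, Finsupp.degree_eq_sum]
  rw [this, Nat.card_coe_set_eq, Set.ncard_coe_finset]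

theorem sub_aeval_mem {R : Type*} [CommRing R] {I : Ideal (MvPolynomial σ R)}
    {v : σ → MvPolynomial σ R} (hv : ∀ i, X i - v i ∈ I) (p : MvPolynomial σ R) :
    p - aeval v p ∈ I := by
  rw [← Ideal.Quotient.mk_eq_mk_iff_sub_mem]
  have : Ideal.Quotient.mkₐ R I = (Ideal.Quotient.mkₐ R I).comp (aeval v) := by
    ext i
    simpa using (Ideal.Quotient.mk_eq_mk_iff_sub_mem _ _).2 (hv i)
  exact DFunLike.congr_fun this p

end MvPolynomial

section HilbertFunction

attribute [local instance] MvPolynomial.gradedAlgebra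

variable {σ : Type*}

theorem gradedPieceDim_span_empty [Fintype σ] (t : ℕ) :
    gradedPieceDim (Ideal.span (∅ : Set (MvPolynomial σ ℂ))) t =
      (Fintype.card σ).multichoose t := by
  rw [gradedPieceDim, ← finrank_homogeneousSubmodule (K := ℂ)]
  refine (LinearEquiv.finrank_eq (Submodule.equivMapOfInjective _ ?_ _)).symm
  rw [injective_iff_map_eq_zero]
  intro p hp
  simpa using Ideal.Quotient.eq_zero_iff_mem.1 hp

/-- Adding to a homogeneous ideal a form of degree `d` that is regular modulo the ideal changes
the Hilbert function as dictated by multiplication by that form. -/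
theorem gradedPieceDim_span_insert [Finite σ] {S : Set (MvPolynomial σ ℂ)}
    (hS : ∀ p ∈ S, ∃ n, p.IsHomogeneous n) {d : ℕ} {f : MvPolynomial σ ℂ}
    (hf : f.IsHomogeneous d)
    (hreg : ∀ p, f * p ∈ Ideal.span S → p ∈ Ideal.span S) (t : ℕ) :
    gradedPieceDim (Ideal.span (insert f S)) (d + t) + gradedPieceDim (Ideal.span S) t =
      gradedPieceDim (Ideal.span S) (d + t) := by
  set I := Ideal.span S with hI
  set J := Ideal.span (insert f S) with hJ
  have hIJ : I ≤ J := Ideal.span_mono (Set.subset_insert _ _)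
  have hfJ : f ∈ J := Ideal.subset_span (Set.mem_insert _ _)
  have hIhom : I.IsHomogeneous (homogeneousSubmodule σ ℂ) := Ideal.homogeneous_span _ _ hS
  let π : (MvPolynomial σ ℂ ⧸ I) →ₗ[ℂ] (MvPolynomial σ ℂ ⧸ J) :=
    (Ideal.Quotient.factorₐ ℂ hIJ).toLinearMap
  let μ : (MvPolynomial σ ℂ ⧸ I) →ₗ[ℂ] (MvPolynomial σ ℂ ⧸ I) :=
    LinearMap.mulLeft ℂ (Ideal.Quotient.mk I f)
  let M : ℕ → Submodule ℂ (MvPolynomial σ ℂ ⧸ I) := fun n =>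
    (homogeneousSubmodule σ ℂ n).map (Ideal.Quotient.mkₐ ℂ I).toLinearMap
  have hfin : Module.Finite ℂ (M (d + t)) :=
    Module.Finite.iff_fg.2 ((homogeneousSubmodule_fg σ ℂ _).map _)
  have hμ : Function.Injective μ := by
    rw [injective_iff_map_eq_zero]
    intro x hx
    obtain ⟨p, rfl⟩ := Ideal.Quotient.mk_surjective x
    rw [LinearMap.mulLeft_apply, ← map_mul, Ideal.Quotient.eq_zero_iff_mem] at hx
    exact Ideal.Quotient.eq_zero_iff_mem.2 (hreg p hx)
  have hmap : (homogeneousSubmodule σ ℂ (d + t)).map (Ideal.Quotient.mkₐ ℂ J).toLinearMap =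
      (M (d + t)).map π := by
    rw [← Submodule.map_comp]
    rfl
  have hker : M (d + t) ⊓ LinearMap.ker π = (M t).map μ := by
    ext x
    constructor
    · rintro ⟨⟨p, hp, rfl⟩, hx⟩
      have hpJ : p ∈ J := Ideal.Quotient.eq_zero_iff_mem.1 hx
      rw [hJ, Ideal.mem_span_insert'] at hpJ
      obtain ⟨a, ha⟩ := hpJ
      have hc := homogeneousComponent_mem_of_mem hIhom ha (d + t)
      rw [map_add, homogeneousComponent_eq_self hp, mul_comm,
        homogeneousComponent_add_mul_of_isHomogeneous hf] at hc
      refine ⟨_, ⟨-homogeneousComponent t a, neg_mem (homogeneousComponent_mem t a), rfl⟩, ?_⟩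
      change Ideal.Quotient.mk I f * Ideal.Quotient.mk I (-homogeneousComponent t a) =
        Ideal.Quotient.mk I p
      rw [← map_mul, eq_comm, Ideal.Quotient.mk_eq_mk_iff_sub_mem]
      simpa using hc
    · rintro ⟨_, ⟨p, hp, rfl⟩, rfl⟩
      refine ⟨⟨f * p, hf.mul hp, rfl⟩, ?_⟩
      exact Ideal.Quotient.eq_zero_iff_mem.2 (J.mul_mem_right p hfJ)
  have hkerrank : Module.finrank ℂ (LinearMap.ker (π.domRestrict (M (d + t)))) =
      Module.finrank ℂ (M t) := by
    rw [LinearEquiv.finrank_eq (Submodule.equivMapOfInjective μ hμ (M t)), ← hker,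
      LinearMap.ker_domRestrict, ← Submodule.map_comap_subtype]
    exact LinearEquiv.finrank_eq
      (Submodule.equivMapOfInjective _ (Submodule.subtype_injective _) _)
  have hrank := LinearMap.finrank_range_add_finrank_ker (π.domRestrict (M (d + t)))
  rwa [LinearMap.range_domRestrict, hkerrank, ← hmap] at hrank

end HilbertFunction

section TangentCone

/-- The generator `x_{13}x_{22} - x_{23}x_{12}`. -/
noncomputable def minorForm : MvPolynomial KLVar ℂ :=
  xv 0 2 (by decide) * xv 1 1 (by decide) - xv 1 2 (by decide) * xv 0 1 (by decide)

/-- The generator `x_{14}x_{31} + x_{13}x_{41} + x_{12}x_{51}`. -/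
noncomputable def bilinearForm : MvPolynomial KLVar ℂ :=
  xv 0 3 (by decide) * xv 2 0 (by decide) + xv 0 2 (by decide) * xv 3 0 (by decide) +
    xv 0 1 (by decide) * xv 4 0 (by decide)

theorem isHomogeneous_xv (i j : Fin 5) (h : (i : ℕ) + (j : ℕ) ≤ 4) :
    (xv i j h).IsHomogeneous 1 :=
  isHomogeneous_X _ _

theorem isHomogeneous_minorForm : minorForm.IsHomogeneous 2 :=
  ((isHomogeneous_xv _ _ _).mul (isHomogeneous_xv _ _ _)).sub
    ((isHomogeneous_xv _ _ _).mul (isHomogeneous_xv _ _ _))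

theorem isHomogeneous_bilinearForm : bilinearForm.IsHomogeneous 2 :=
  (((isHomogeneous_xv _ _ _).mul (isHomogeneous_xv _ _ _)).add
    ((isHomogeneous_xv _ _ _).mul (isHomogeneous_xv _ _ _))).add
    ((isHomogeneous_xv _ _ _).mul (isHomogeneous_xv _ _ _))

theorem prime_minorForm : Prime minorForm := by
  have hX (p : KLVar) : Prime (X p : MvPolynomial KLVar ℂ) := X_prime
  have hirr : Irreducible (xv 0 2 (by decide) * X ⟨(1, 1), by decide⟩ +
      -(xv 1 2 (by decide) * xv 0 1 (by decide))) := by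
    apply irreducible_mul_X_add
    · exact X_ne_zero _
    · simp [xv, vars_X]
    · rw [vars_neg]
      intro h
      have := vars_mul _ _ h
      simp [xv, vars_X] at this
    · rw [IsRelPrime.neg_right_iff]
      refine (hX _).irreducible.isRelPrime_iff_not_dvd.2 fun h => ?_
      rcases (hX _).dvd_or_dvd h with h | h <;>
      · simp [xv, X_dvd_X] at h
  rw [← sub_eq_add_neg] at hirr
  exact hirr.prime

theorem not_minorForm_dvd_bilinearForm : ¬ minorForm ∣ bilinearForm := by
  intro h
  have := map_dvd (eval fun p : KLVar =>
    if p.1 = (0, 3) ∨ p.1 = (2, 0) then (1 : ℂ) else 0) h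
  simp [minorForm, bilinearForm, xv] at this

/-- Setting `x_{11}` and `x_{21}` to zero. -/
noncomputable def killLinear : MvPolynomial KLVar ℂ →ₐ[ℂ] MvPolynomial KLVar ℂ :=
  aeval fun p => if p.1 = (0, 0) ∨ p.1 = (1, 0) then 0 else X p

theorem killLinear_minorForm : killLinear minorForm = minorForm := by
  simp [killLinear, minorForm, xv]

theorem killLinear_bilinearForm : killLinear bilinearForm = bilinearForm := by
  simp [killLinear, bilinearForm, xv]

theorem sub_killLinear_mem (p : MvPolynomial KLVar ℂ) :
    p - killLinear p ∈ Ideal.span {xv 1 0 (by decide), xv 0 0 (by decide)} := by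
  refine sub_aeval_mem (fun i => ?_) p
  obtain ⟨i, hi⟩ := i
  split_ifs with h
  · rcases h with rfl | rfl
    · rw [sub_zero]
      exact Ideal.subset_span (Set.mem_insert_of_mem _ (Set.mem_singleton _))
    · rw [sub_zero]
      exact Ideal.subset_span (Set.mem_insert _ _)
  · rw [sub_self]
    exact zero_mem _

theorem killLinear_eq_zero_of_mem {p : MvPolynomial KLVar ℂ}
    (hp : p ∈ Ideal.span {xv 1 0 (by decide), xv 0 0 (by decide)}) : killLinear p = 0 := by
  rw [← RingHom.mem_ker]
  refine (Ideal.span_le.2 ?_) hp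
  rintro _ (rfl | rfl) <;> simp [killLinear, xv]

theorem regular_xv_zero_zero (p : MvPolynomial KLVar ℂ)
    (hp : xv 0 0 (by decide) * p ∈ Ideal.span {xv 1 0 (by decide)}) :
    p ∈ Ideal.span {xv 1 0 (by decide)} := by
  rw [Ideal.mem_span_singleton] at hp ⊢
  refine (Prime.dvd_or_dvd (X_prime (R := ℂ)) hp).resolve_left ?_
  simp [xv, X_dvd_X]

theorem regular_minorForm (p : MvPolynomial KLVar ℂ)
    (hp : minorForm * p ∈ Ideal.span {xv 1 0 (by decide), xv 0 0 (by decide)}) :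
    p ∈ Ideal.span {xv 1 0 (by decide), xv 0 0 (by decide)} := by
  have h := killLinear_eq_zero_of_mem hp
  rw [map_mul, killLinear_minorForm] at h
  simpa [(mul_eq_zero.1 h).resolve_left prime_minorForm.ne_zero] using sub_killLinear_mem p

theorem regular_bilinearForm (p : MvPolynomial KLVar ℂ)
    (hp : bilinearForm * p ∈
      Ideal.span {minorForm, xv 1 0 (by decide), xv 0 0 (by decide)}) :
    p ∈ Ideal.span {minorForm, xv 1 0 (by decide), xv 0 0 (by decide)} := by
  obtain ⟨a, ha⟩ := (Ideal.mem_span_insert' _ _ _).1 hp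
  have h := killLinear_eq_zero_of_mem ha
  rw [map_add, map_mul, map_mul, killLinear_minorForm, killLinear_bilinearForm,
    add_eq_zero_iff_eq_neg, ← neg_mul] at h
  obtain ⟨b, hb⟩ := (prime_minorForm.dvd_or_dvd (Dvd.intro_left _ h.symm)).resolve_left
    not_minorForm_dvd_bilinearForm
  refine (Ideal.mem_span_insert' _ _ _).2 ⟨-b, ?_⟩
  have := sub_killLinear_mem p
  rw [hb] at this
  convert this using 1
  ring

theorem gradedPieceDim_tangentCone (t : ℕ) :
    gradedPieceDim (Ideal.span
      {bilinearForm, minorForm, xv 1 0 (by decide), xv 0 0 (by decide)}) (t + 6) =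
      (t + 16).choose 10 + 2 * (t + 15).choose 10 + (t + 14).choose 10 := by
  have hcard : Fintype.card KLVar = 15 := by decide
  have hx (i j : Fin 5) (h : (i : ℕ) + (j : ℕ) ≤ 4) : ∃ n, (xv i j h).IsHomogeneous n :=
    ⟨1, isHomogeneous_xv i j h⟩
  have dim₀ (s : ℕ) : gradedPieceDim (Ideal.span (∅ : Set (MvPolynomial KLVar ℂ))) s =
      (s + 14).choose 14 := by
    rw [gradedPieceDim_span_empty, hcard, Nat.multichoose_eq,
      show 15 + s - 1 = s + 14 by lia, Nat.choose_symm_add]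
  have dim₁ (s : ℕ) : gradedPieceDim (Ideal.span {xv 1 0 (by decide)}) (1 + s) =
      (s + 14).choose 13 := by
    have h := gradedPieceDim_span_insert (S := ∅) (by simp) (isHomogeneous_xv 1 0 (by decide))
      (fun p hp => by simpa [xv] using hp) s
    rw [dim₀, dim₀, insert_empty_eq, show 1 + s + 14 = s + 14 + 1 by lia,
      Nat.choose_succ_succ' (s + 14) 13] at h
    lia
  have dim₂ (s : ℕ) :
      gradedPieceDim (Ideal.span {xv 1 0 (by decide), xv 0 0 (by decide)}) (1 + (1 + s)) =
      (s + 14).choose 12 := by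
    have h := gradedPieceDim_span_insert (S := {xv 1 0 (by decide)})
      (by rintro _ rfl; exact hx ..) (isHomogeneous_xv 0 0 (by decide))
      regular_xv_zero_zero (1 + s)
    rw [dim₁, dim₁, Set.pair_comm, show 1 + s + 14 = s + 14 + 1 by lia,
      Nat.choose_succ_succ' (s + 14) 12] at h
    lia
  have dim₃ (s : ℕ) :
      gradedPieceDim (Ideal.span {minorForm, xv 1 0 (by decide), xv 0 0 (by decide)})
        (2 + (1 + (1 + s))) = (s + 15).choose 11 + (s + 14).choose 11 := by
    have h := gradedPieceDim_span_insert (S := {xv 1 0 (by decide), xv 0 0 (by decide)})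
      (by rintro _ (rfl | rfl) <;> exact hx ..) isHomogeneous_minorForm
      regular_minorForm (1 + (1 + s))
    rw [dim₂, show 2 + (1 + (1 + s)) = 1 + (1 + (s + 2)) by lia, dim₂] at h
    have h₁ := Nat.choose_succ_succ' (s + 15) 11
    have h₂ := Nat.choose_succ_succ' (s + 14) 11
    rw [show 2 + (1 + (1 + s)) = 1 + (1 + (s + 2)) by lia]
    lia
  have h := gradedPieceDim_span_insert
    (S := {minorForm, xv 1 0 (by decide), xv 0 0 (by decide)})
    (by
      rintro _ (rfl | rfl | rfl)
      exacts [⟨2, isHomogeneous_minorForm⟩, hx .., hx ..])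
    isHomogeneous_bilinearForm regular_bilinearForm (2 + (1 + (1 + t)))
  have h₁ := Nat.choose_succ_succ' (t + 16) 10
  have h₂ := Nat.choose_succ_succ' (t + 15) 10
  have h₃ := Nat.choose_succ_succ' (t + 14) 10
  rw [dim₃, show 2 + (2 + (1 + (1 + t))) = 2 + (1 + (1 + (t + 2))) by lia, dim₃] at h
  rw [show t + 6 = 2 + (1 + (1 + (t + 2))) by lia]
  lia

end TangentCone

/-- The tangent-cone ideal
`I = ⟨x_{21}, x_{11}, x_{13}x_{22} - x_{23}x_{12}, x_{14}x_{31} + x_{13}x_{41} + x_{12}x_{51}⟩`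
defines a projective variety of degree `4`; this is the Hilbert–Samuel multiplicity of the
Schubert variety `X_{463512}` at the identity coset. -/
theorem degree_tangent_cone_schubert_463512 :
    VarietyHasDegree
      (Ideal.span
        ({ xv 1 0 (by decide), xv 0 0 (by decide),
           xv 0 2 (by decide) * xv 1 1 (by decide) -
             xv 1 2 (by decide) * xv 0 1 (by decide),
           xv 0 3 (by decide) * xv 2 0 (by decide) +
             xv 0 2 (by decide) * xv 3 0 (by decide) +
             xv 0 1 (by decide) * xv 4 0 (by decide) } :
          Set (MvPolynomial KLVar ℂ)))
      4 := by
  have hset : ({ xv 1 0 (by decide), xv 0 0 (by decide),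
      xv 0 2 (by decide) * xv 1 1 (by decide) - xv 1 2 (by decide) * xv 0 1 (by decide),
      xv 0 3 (by decide) * xv 2 0 (by decide) + xv 0 2 (by decide) * xv 3 0 (by decide) +
        xv 0 1 (by decide) * xv 4 0 (by decide) } : Set (MvPolynomial KLVar ℂ)) =
      {bilinearForm, minorForm, xv 1 0 (by decide), xv 0 0 (by decide)} := by
    ext p
    simp only [Set.mem_insert_iff, Set.mem_singleton_iff, bilinearForm, minorForm]
    tauto
  rw [hset]
  let P : Polynomial ℚ := Polynomial.preHilbertPoly ℚ 10 0 +
    2 * Polynomial.preHilbertPoly ℚ 10 1 + Polynomial.preHilbertPoly ℚ 10 2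
  have hcoeff : P.coeff 10 = 4 * ((Nat.factorial 10 : ℕ) : ℚ)⁻¹ := by
    simp only [P, Polynomial.coeff_add, Polynomial.coeff_ofNat_mul,
      Polynomial.coeff_preHilbertPoly_self]
    ring
  have hdeg : P.natDegree = 10 := by
    refine Polynomial.natDegree_eq_of_le_of_coeff_ne_zero ?_ ?_
    · have h (k : ℕ) := (Polynomial.natDegree_preHilbertPoly ℚ 10 k).le
      refine Polynomial.natDegree_add_le_of_degree_le
        (Polynomial.natDegree_add_le_of_degree_le (h 0) ?_) (h 2)
      exact (Polynomial.natDegree_C_mul_le (2 : ℚ) _).trans (h 1)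
    · rw [hcoeff]
      positivity
  refine ⟨P, ⟨6, fun t ht => ?_⟩, ?_⟩
  · obtain ⟨s, rfl⟩ := Nat.exists_eq_add_of_le' ht
    rw [gradedPieceDim_tangentCone]
    simp only [P, Polynomial.eval_add, Polynomial.eval_mul, Polynomial.eval_ofNat]
    rw [Polynomial.preHilbertPoly_eq_choose_sub_add ℚ 10 (by lia),
      Polynomial.preHilbertPoly_eq_choose_sub_add ℚ 10 (by lia),
      Polynomial.preHilbertPoly_eq_choose_sub_add ℚ 10 (by lia)]
    push_cast
    rfl
  · rw [Polynomial.leadingCoeff, hdeg, hcoeff]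
    norm_num [Nat.factorial]
end
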